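/- Let n ≥ 2, let z_1, …, z_n ∈ ℂ be distinct, let m_1, …, m_n > 0, let γ = 0, and let η(z) = z − Σ_{j=1}^n m_j/(conj(z) − conj(z_j)) on ℂ \ {z_1, …, z_n}. Then for every ζ ∈ ℂ, the set of images {z ∈ ℂ \ {z_1, …, z_n} : η(z) = ζ} is finite and has at most 5n − 5 elements. -/

import Mathlib

namespace KN
open Set Filter Topology Metric

lemma hasDerivAt_iterate_prod {Q : ℂ → ℂ} {B : Set ℂ} (hB : IsOpen B) (hd : DifferentiableOn ℂ Q B)
    (hmaps : MapsTo Q B B) (k : ℕ) {x : ℂ} (hx : x ∈ B) :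
    HasDerivAt (Q^[k]) (∏ j ∈ Finset.range k, deriv Q (Q^[j] x)) x := by
  induction k with
  | zero => simpa using hasDerivAt_id x
  | succ k ih =>
    rw [Function.iterate_succ', Finset.prod_range_succ, mul_comm]
    have h1 : HasDerivAt Q (deriv Q (Q^[k] x)) (Q^[k] x) :=
      (hd.differentiableAt (hB.mem_nhds (hmaps.iterate k hx))).hasDerivAt
    exact h1.comp x ih

lemma isCoveringMap_restrict (B : Set ℂ) (hB : IsOpen B)
    (Q : ℂ → ℂ) (hd : DifferentiableOn ℂ Q B) (hmaps : MapsTo Q B B)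
    (hprop : ∀ K ⊆ B, IsCompact K → IsCompact (B ∩ Q ⁻¹' K))
    (hcrit : ∀ w ∈ B, deriv Q w ≠ 0) : IsCoveringMap (hmaps.restrict Q B B) := by
  have hcont : Continuous (hmaps.restrict Q B B) := hd.continuousOn.mapsToRestrict hmaps
  have : LocallyCompactSpace B := hB.locallyCompactSpace
  have hpr : IsProperMap (hmaps.restrict Q B B) := by
    rw [isProperMap_iff_isCompact_preimage]
    refine ⟨hcont, fun K hK => ?_⟩
    have h1 := hprop (Subtype.val '' K) (by rintro _ ⟨x, _, rfl⟩; exact x.2)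
      (hK.image continuous_subtype_val)
    rw [Subtype.isCompact_iff]
    convert h1 using 1
    ext x
    constructor
    · rintro ⟨y, hy, rfl⟩
      exact ⟨y.2, _, hy, rfl⟩
    · rintro ⟨hx, y, hy, hxy⟩
      refine ⟨⟨x, hx⟩, ?_, rfl⟩
      have : hmaps.restrict Q B B ⟨x, hx⟩ = y := Subtype.ext hxy.symm
      rw [mem_preimage, this]; exact hy
  have hQ : IsLocalHomeomorphOn Q B := by
    intro x hx
    have hs : HasStrictDerivAt Q (deriv Q x) x :=
      (hd.analyticAt (hB.mem_nhds hx)).hasStrictDerivAt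
    have hs' := hs.hasStrictFDerivAt_equiv (hcrit x hx)
    exact ⟨hs'.toOpenPartialHomeomorph Q, hs'.mem_toOpenPartialHomeomorph_source, rfl⟩
  have hval : IsLocalHomeomorph (Subtype.val : B → ℂ) :=
    hB.isOpenEmbedding_subtypeVal.isLocalHomeomorph
  have hloc : IsLocalHomeomorph (hmaps.restrict Q B B) := by
    refine IsLocalHomeomorph.of_comp ?_ hval hcont
    have : IsLocalHomeomorphOn (Q ∘ (Subtype.val : B → ℂ)) univ :=
      IsLocalHomeomorphOn.comp (t := B) hQ (isLocalHomeomorph_iff_isLocalHomeomorphOn_univ.1 hval)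
        (fun x _ => x.2)
    exact isLocalHomeomorph_iff_isLocalHomeomorphOn_univ.2 this
  rw [isCoveringMap_iff_isCoveringMapOn_univ]
  refine hpr.isClosedMap.isCoveringMapOn_of_isLocalHomeomorphOn (fun x _ => ?_) ?_
  · refine (hpr.isCompact_preimage isCompact_singleton).finite ?_
    refine .of_openPartialHomeomorph _ subset_rfl fun e _ => ?_
    obtain ⟨φ, h1, h2⟩ := hloc e
    exact ⟨φ, h1, h2.symm⟩
  · exact fun x _ => hloc x

theorem lift_bound (B : Set ℂ) (hB : IsOpen B) (M : ℝ) (hM : ∀ w ∈ B, ‖w‖ ≤ M)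
    (Q : ℂ → ℂ) (hd : DifferentiableOn ℂ Q B) (hmaps : MapsTo Q B B)
    (hprop : ∀ K ⊆ B, IsCompact K → IsCompact (B ∩ Q ⁻¹' K))
    (hcrit : ∀ w ∈ B, deriv Q w ≠ 0) (u : ℂ) (hu : u ∈ B) (k : ℕ) (ρ : ℝ) (hρ : 0 < ρ)
    (hball : ball (Q^[k] u) ρ ⊆ B) :
    ρ ≤ (2 * M + 1) * ∏ j ∈ Finset.range k, ‖deriv Q (Q^[j] u)‖ := by
  have cov := isCoveringMap_restrict B hB Q hd hmaps hprop hcrit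
  set v := Q^[k] u with hv
  have hvD : v ∈ ball v ρ := mem_ball_self hρ
  have : ContractibleSpace (ball v ρ) := (convex_ball v ρ).contractibleSpace ⟨v, hvD⟩
  have : LocallyPathConnectedSpace (ball v ρ) := isOpen_ball.locallyPathConnectedSpace
  have key : ∀ k : ℕ, ∀ u ∈ B, Q^[k] u = v → ∃ h : C(ball v ρ, B), (h ⟨v, hvD⟩ : ℂ) = u ∧
      ∀ x, Q^[k] (h x) = x := by
    intro k
    induction k with
    | zero =>
      intro u hu huv
      refine ⟨⟨fun x => ⟨x, hball x.2⟩, by fun_prop⟩, by simpa using huv.symm, fun x => rfl⟩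
    | succ k ih =>
      intro u hu huv
      obtain ⟨h1, h1v, h1x⟩ := ih (Q u) (hmaps hu) (by simpa using huv)
      obtain ⟨h, ⟨ha, hb⟩, -⟩ := cov.existsUnique_continuousMap_lifts h1 ⟨v, hvD⟩ ⟨u, hu⟩
        (Subtype.ext h1v.symm)
      refine ⟨h, by rw [ha], fun x => ?_⟩
      have := congrArg Subtype.val (congrFun hb x)
      change Q (h x) = h1 x at this
      rw [Function.iterate_succ_apply, this, h1x]
  obtain ⟨h, hhv, hhx⟩ := key k u hu rfl
  classical
  let g : ℂ → ℂ := fun x => if hx : x ∈ ball v ρ then (h ⟨x, hx⟩ : ℂ) else 0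
  have gdef : ∀ x (hx : x ∈ ball v ρ), g x = h ⟨x, hx⟩ := fun x hx => dif_pos hx
  have gB : ∀ x ∈ ball v ρ, g x ∈ B := fun x hx => by rw [gdef x hx]; exact (h _).2
  have gcont : ContinuousOn g (ball v ρ) := by
    rw [continuousOn_iff_continuous_domRestrict]
    have : (ball v ρ).domRestrict g = fun x => (h x : ℂ) := by
      ext x; exact gdef x x.2
    rw [this]; fun_prop
  have gder : ∀ x ∈ ball v ρ,
      HasDerivAt g (∏ j ∈ Finset.range k, deriv Q (Q^[j] (g x)))⁻¹ x := by
    intro x hx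
    refine HasDerivAt.of_local_left_inverse (f := Q^[k])
      (gcont.continuousAt (isOpen_ball.mem_nhds hx))
      (hasDerivAt_iterate_prod hB hd hmaps k (gB x hx)) ?_ ?_
    · exact Finset.prod_ne_zero_iff.2 fun j _ => hcrit _ (hmaps.iterate j (gB x hx))
    · filter_upwards [isOpen_ball.mem_nhds hx] with y hy
      rw [gdef y hy]; exact hhx _
  have gv : g v = u := by rw [gdef v hvD]; exact hhv
  have hP : 0 < ∏ j ∈ Finset.range k, ‖deriv Q (Q^[j] u)‖ :=
    Finset.prod_pos fun j _ => norm_pos_iff.2 (hcrit _ (hmaps.iterate j hu))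
  have hbound := Complex.norm_deriv_le_div_of_mapsTo_ball (f := g) (c := v) (R₁ := ρ)
    (R₂ := 2 * M + 1) (fun x hx => (gder x hx).differentiableAt.differentiableWithinAt)
    (fun x hx => by
      rw [mem_closedBall, dist_eq_norm]
      have := norm_sub_le (g x) (g v)
      have h1 := hM _ (gB x hx)
      have h2 := hM _ (gB v hvD)
      linarith) hρ
  rw [(gder v hvD).deriv, gv, norm_inv, norm_prod] at hbound
  rw [inv_le_iff_one_le_mul₀ hP, div_mul_eq_mul_div, one_le_div hρ] at hbound
  exact hbound

end KN


namespace KN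
open Set Filter Topology Metric

/-- attracting germ -/
lemma germ_attracting (Q : ℂ → ℂ) (z0 : ℂ) (hdf : DifferentiableAt ℂ Q z0) (hfix : Q z0 = z0)
    (hder : ‖deriv Q z0‖ < 1) (W : Set ℂ) (hW : W ∈ 𝓝 z0) :
    ∃ U ⊆ W, IsOpen U ∧ MapsTo Q U U ∧ (∀ z ∈ U, Tendsto (fun k => Q^[k] z) atTop (𝓝 z0)) ∧
      ∃ u ∈ U, ∃ ρ : ℕ → ℝ, (∀ k, 0 < ρ k) ∧ (∀ k, ball (Q^[k] u) (ρ k) ⊆ U) ∧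
      Tendsto (fun k => (∏ j ∈ Finset.range k, ‖deriv Q (Q^[j] u)‖) / ρ k) atTop (𝓝 0) := by
  obtain ⟨μ, hμ1, hμ2⟩ := exists_between hder
  have hμ0 : 0 ≤ μ := (norm_nonneg _).trans hμ1.le
  have h1 : ∀ᶠ z in 𝓝 z0, ‖Q z - z0‖ ≤ μ * ‖z - z0‖ := by
    have := hdf.hasDerivAt.isLittleO.def (sub_pos.2 hμ1)
    filter_upwards [this] with z hz
    rw [hfix] at hz
    have h2 := norm_add_le (Q z - z0 - (z - z0) • deriv Q z0) ((z - z0) • deriv Q z0)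
    rw [sub_add_cancel, norm_smul] at h2
    nlinarith
  obtain ⟨r, hr, hr2⟩ := Metric.mem_nhds_iff.1 (Filter.inter_mem hW h1)
  have hmaps : MapsTo Q (ball z0 r) (ball z0 r) := by
    intro z hz
    have h2 := (hr2 hz).2
    rw [mem_ball, dist_eq_norm] at hz ⊢
    have : ‖Q z - z0‖ ≤ μ * ‖z - z0‖ := h2
    nlinarith [norm_nonneg (z - z0)]
  have hfixk : ∀ k, Q^[k] z0 = z0 := fun k => Function.iterate_fixed hfix k
  refine ⟨ball z0 r, fun z hz => (hr2 hz).1, isOpen_ball, hmaps, fun z hz => ?_, z0,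
    mem_ball_self hr, fun _ => r, fun _ => hr, fun k => by rw [hfixk], ?_⟩
  · have hb : ∀ k, ‖Q^[k] z - z0‖ ≤ μ ^ k * ‖z - z0‖ := by
      intro k
      induction k with
      | zero => simp
      | succ k ih =>
        rw [Function.iterate_succ_apply']
        have : ‖Q (Q^[k] z) - z0‖ ≤ μ * ‖Q^[k] z - z0‖ := (hr2 (hmaps.iterate k hz)).2
        calc _ ≤ _ := this
          _ ≤ μ * (μ ^ k * ‖z - z0‖) := by gcongr
          _ = _ := by ring
    rw [tendsto_iff_norm_sub_tendsto_zero]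
    refine squeeze_zero (fun _ => norm_nonneg _) hb ?_
    simpa using (tendsto_pow_atTop_nhds_zero_of_lt_one hμ0 hμ2).mul_const (‖z - z0‖)
  · simp only [hfixk, Finset.prod_const, Finset.card_range]
    simpa using (tendsto_pow_atTop_nhds_zero_of_lt_one (norm_nonneg _) hder).div_const r

lemma parabolic_factor {w e : ℂ} (h3 : ‖w‖ ≤ 3 * w.re) (h6 : 6 ≤ ‖w‖) (he : ‖e - 1‖ ≤ 1 / 12) :
    ‖1 - e / w‖ ≤ 1 - 1 / (6 * ‖w‖) := by
  have hw : w ≠ 0 := by rintro rfl; simp at h6; linarith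
  have hpos : 0 < ‖w‖ := by linarith
  have h1 : ‖1 - 1 / w‖ ≤ 1 - 1 / (4 * ‖w‖) := by
    have h4 : 0 ≤ 1 - 1 / (4 * ‖w‖) := by
      rw [sub_nonneg, div_le_one (by positivity)]; linarith
    refine le_of_sq_le_sq ?_ h4 
    have e1 : 1 - 1 / w = (w - 1) / w := by field_simp
    rw [e1, norm_div, div_pow]
    have e2 : ‖w - 1‖ ^ 2 = ‖w‖ ^ 2 - 2 * w.re + 1 := by
      rw [Complex.sq_norm, Complex.sq_norm, Complex.normSq_apply, Complex.normSq_apply]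
      simp; ring
    rw [e2, div_le_iff₀ (by positivity)]
    have e3 : (1 - 1 / (4 * ‖w‖)) ^ 2 * ‖w‖ ^ 2 = (‖w‖ - 1 / 4) ^ 2 := by
      field_simp
    rw [e3]
    nlinarith
  have e4 : 1 - e / w = (1 - 1 / w) - (e - 1) / w := by field_simp; ring
  rw [e4]
  refine (norm_sub_le _ _).trans ?_
  rw [norm_div]
  have h5 : ‖e - 1‖ / ‖w‖ ≤ 1 / 12 / ‖w‖ := by gcongr
  have e5 : 1 - 1 / (4 * ‖w‖) + 1 / 12 / ‖w‖ = 1 - 1 / (6 * ‖w‖) := by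
    field_simp; ring
  linarith

lemma prod_to_zero (A : ℝ) (hA : 0 < A) (q : ℕ → ℝ) (hq0 : ∀ j, 0 ≤ q j)
    (hq : ∀ j : ℕ, q j ≤ 1 - A * (1 / ((j : ℝ) + 1))) :
    Tendsto (fun k => ∏ j ∈ Finset.range k, q j) atTop (𝓝 0) := by
  have h1 : ∀ k, ∏ j ∈ Finset.range k, q j ≤
      Real.exp (- (A * ∑ j ∈ Finset.range k, 1 / ((j : ℝ) + 1))) := by
    intro k
    rw [Finset.mul_sum, ← Finset.sum_neg_distrib, Real.exp_sum]
    refine Finset.prod_le_prod (fun j _ => hq0 j) fun j _ => (hq j).trans ?_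
    have := Real.add_one_le_exp (-(A * (1 / ((j : ℝ) + 1))))
    linarith
  refine squeeze_zero (fun k => Finset.prod_nonneg fun j _ => hq0 j) h1 ?_
  refine Real.tendsto_exp_neg_atTop_nhds_zero.comp ?_
  exact Tendsto.const_mul_atTop hA Real.tendsto_sum_range_one_div_nat_succ_atTop

/-- parabolic germ: local expansion -/
lemma germ_parabolic_limits (Q : ℂ → ℂ) (z0 : ℂ) (han : AnalyticAt ℂ Q z0) (hfix : Q z0 = z0)
    (hder : deriv Q z0 = 1) (hne : ¬ ∀ᶠ z in 𝓝 z0, Q z = z) :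
    ∃ (p : ℕ) (a : ℂ), p ≠ 0 ∧ a ≠ 0 ∧
      (∀ᶠ z in 𝓝[≠] z0, Q z ≠ z0) ∧
      Tendsto (fun z => -1 / (p * a * (Q z - z0) ^ p) - (-1 / (p * a * (z - z0) ^ p))) (𝓝[≠] z0)
        (𝓝 1) ∧
      Tendsto (fun z => (-1 / (p * a * (z - z0) ^ p)) *
        (1 - deriv Q z * (z - z0) / (Q z - z0))) (𝓝[≠] z0) (𝓝 1) := by
  have hf : AnalyticAt ℂ (fun z => Q z - z) z0 := han.sub analyticAt_id
  obtain ⟨n, g, hg, hg0, hgz⟩ := hf.exists_eventuallyEq_pow_smul_nonzero_iff.2 (by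
    intro h; exact hne (h.mono fun z hz => sub_eq_zero.1 hz))
  have hn2 : ∃ p, n = p + 1 ∧ p ≠ 0 := by
    rcases n with _ | _ | p
    · exfalso
      have := hgz.self_of_nhds
      simp [hfix] at this
      exact hg0 this.symm
    · exfalso
      have h1 : HasDerivAt (fun z => Q z - z) (deriv Q z0 - 1) z0 :=
        han.differentiableAt.hasDerivAt.sub (hasDerivAt_id z0)
      have h2 : HasDerivAt (fun z => (z - z0) ^ (0 + 1) • g z) (g z0) z0 := by
        have h3 := ((hasDerivAt_id z0).sub_const z0).mul hg.differentiableAt.hasDerivAt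
        simp only [id, sub_self, zero_mul, add_zero, one_mul] at h3
        refine h3.congr_of_eventuallyEq (Eventually.of_forall fun z => ?_)
        simp
      have h4 := (h2.congr_of_eventuallyEq hgz).unique h1
      rw [hder] at h4
      exact hg0 (by simpa using h4)
    · exact ⟨p + 1, rfl, by simp⟩
  obtain ⟨p, rfl, hp⟩ := hn2
  set a := g z0 with ha
  have hpc : (p : ℂ) ≠ 0 := by exact_mod_cast hp
  have hgc : Tendsto g (𝓝[≠] z0) (𝓝 a) := hg.continuousAt.tendsto.mono_left nhdsWithin_le_nhds
  have hdc : Tendsto (fun z : ℂ => z - z0) (𝓝[≠] z0) (𝓝 0) := by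
    have : Continuous fun z : ℂ => z - z0 := by fun_prop
    simpa using (this.tendsto z0).mono_left nhdsWithin_le_nhds
  have hg'c : Tendsto (deriv g) (𝓝[≠] z0) (𝓝 (deriv g z0)) :=
    hg.deriv.continuousAt.tendsto.mono_left nhdsWithin_le_nhds
  set s : ℂ → ℂ := fun z => (z - z0) ^ p * g z with hs
  have hsc : Tendsto s (𝓝[≠] z0) (𝓝 0) := by
    have := (hdc.pow p).mul hgc
    simpa [hp] using this
  have h1s : Tendsto (fun z => 1 + s z) (𝓝[≠] z0) (𝓝 1) := by simpa using hsc.const_add 1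
  have h1sne : ∀ᶠ z in 𝓝[≠] z0, 1 + s z ≠ 0 := h1s.eventually_ne one_ne_zero
  have hzne : ∀ᶠ z in 𝓝[≠] z0, z - z0 ≠ 0 := by
    filter_upwards [self_mem_nhdsWithin] with z hz
    exact sub_ne_zero.2 hz
  have hQ : ∀ᶠ z in 𝓝[≠] z0, Q z - z0 = (z - z0) * (1 + s z) := by
    filter_upwards [nhdsWithin_le_nhds hgz] with z hz
    simp only [smul_eq_mul, hs] at hz ⊢
    linear_combination hz
  have hQ' : ∀ᶠ z in 𝓝[≠] z0, deriv Q z =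
      1 + (p + 1) * s z + (z - z0) ^ (p + 1) * deriv g z := by
    filter_upwards [nhdsWithin_le_nhds hgz.eventually_nhds,
      nhdsWithin_le_nhds hg.eventually_analyticAt] with z hz hgz
    have h1 : Q =ᶠ[𝓝 z] fun y => y + (y - z0) ^ (p + 1) * g y := by
      filter_upwards [hz] with y hy
      simp only [smul_eq_mul] at hy
      linear_combination hy
    rw [h1.deriv_eq]
    have h2 := (hasDerivAt_id z).add ((((hasDerivAt_id z).sub_const z0).pow (p + 1)).mul
      hgz.differentiableAt.hasDerivAt)
    have h3 := h2.deriv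
    simp only [id] at h3
    refine Eq.trans ?_ (h3.trans ?_)
    · rfl
    · simp only [hs]; push_cast; simp; ring
  refine ⟨p, a, hp, hg0, ?_, ?_, ?_⟩
  · filter_upwards [hQ, h1sne, hzne] with z h1 h2 h3
    rw [← sub_ne_zero, h1]
    exact mul_ne_zero h3 h2
  · have hlim : Tendsto (fun z => g z * (∑ i ∈ Finset.range p, (1 + s z) ^ i) /
        (p * a * (1 + s z) ^ p)) (𝓝[≠] z0) (𝓝 1) := by
      have h1 : Tendsto (fun z => ∑ i ∈ Finset.range p, (1 + s z) ^ i) (𝓝[≠] z0)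
          (𝓝 (∑ i ∈ Finset.range p, (1 : ℂ) ^ i)) :=
        tendsto_finsetSum _ fun i _ => h1s.pow i
      have h2 := (hgc.mul h1).div ((h1s.pow p).const_mul (p * a)) (by
        simp [hpc, hg0])
      convert h2 using 2
      simp
      field_simp
      simp
    refine hlim.congr' ?_
    filter_upwards [hQ, h1sne, hzne] with z h1 h2 h3
    rw [h1, mul_pow]
    have h4 := mul_geom_sum (1 + s z) p
    have h5 : s z * ∑ i ∈ Finset.range p, (1 + s z) ^ i = (1 + s z) ^ p - 1 := by
      rw [← h4]; ring
    have h6 : (z - z0) ^ p ≠ 0 := pow_ne_zero _ h3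
    have h7 : (1 + s z) ^ p ≠ 0 := pow_ne_zero _ h2
    have h8 : g z = s z / (z - z0) ^ p := by simp only [hs]; field_simp
    rw [h8, div_mul_eq_mul_div, h5]
    field_simp
    ring
  · have hlim : Tendsto (fun z => (p * g z + (z - z0) * deriv g z) /
        (p * a * (1 + s z))) (𝓝[≠] z0) (𝓝 1) := by
      have h2 := ((hgc.const_mul (p : ℂ)).add (hdc.mul hg'c)).div (h1s.const_mul (p * a)) (by
        simp [hpc, hg0])
      convert h2 using 2
      simp
      field_simp
      simp
    refine hlim.congr' ?_
    filter_upwards [hQ, hQ', h1sne, hzne] with z h1 h0 h2 h3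
    rw [h1, h0]
    have h6 : (z - z0) ^ p ≠ 0 := pow_ne_zero _ h3
    have h9 : 1 - (1 + (p + 1) * s z + (z - z0) ^ (p + 1) * deriv g z) * (z - z0) /
        ((z - z0) * (1 + s z)) = - (z - z0) ^ p * (p * g z + (z - z0) * deriv g z) / (1 + s z) := by
      field_simp
      simp only [hs]
      ring
    rw [h9]
    field_simp


/-- parabolic germ -/
lemma germ_parabolic (Q : ℂ → ℂ) (z0 : ℂ) (han : AnalyticAt ℂ Q z0) (hfix : Q z0 = z0)
    (hder : deriv Q z0 = 1) (hne : ¬ ∀ᶠ z in 𝓝 z0, Q z = z) (W : Set ℂ) (hW : W ∈ 𝓝 z0) :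
    ∃ U ⊆ W, IsOpen U ∧ MapsTo Q U U ∧ (∀ z ∈ U, Tendsto (fun k => Q^[k] z) atTop (𝓝 z0)) ∧
      ∃ u ∈ U, ∃ ρ : ℕ → ℝ, (∀ k, 0 < ρ k) ∧ (∀ k, ball (Q^[k] u) (ρ k) ⊆ U) ∧
      Tendsto (fun k => (∏ j ∈ Finset.range k, ‖deriv Q (Q^[j] u)‖) / ρ k) atTop (𝓝 0) := by
  obtain ⟨p, a, hp, ha, hQne, hL1, hL2⟩ := germ_parabolic_limits Q z0 han hfix hder hne
  have hpc : (p : ℂ) ≠ 0 := by exact_mod_cast hp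
  have hpa : (p : ℂ) * a ≠ 0 := mul_ne_zero hpc ha
  have hpan : 0 < ‖(p : ℂ) * a‖ := norm_pos_iff.2 hpa
  set ω : ℂ → ℂ := fun z => -1 / (p * a * (z - z0) ^ p) with hω
  have hE1 : ∀ᶠ z in 𝓝[≠] z0, ‖ω (Q z) - ω z - 1‖ ≤ 1 / 2 := by
    have := Metric.tendsto_nhds.1 hL1 (1 / 2) (by norm_num)
    filter_upwards [this] with z hz
    rw [dist_eq_norm] at hz
    exact hz.le
  have hE2 : ∀ᶠ z in 𝓝[≠] z0, ‖ω z * (1 - deriv Q z * (z - z0) / (Q z - z0)) - 1‖ ≤ 1 / 12 := by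
    have := Metric.tendsto_nhds.1 hL2 (1 / 12) (by norm_num)
    filter_upwards [this] with z hz
    rw [dist_eq_norm] at hz
    exact hz.le
  have hW' : ∀ᶠ z in 𝓝[≠] z0, z ∈ W := nhdsWithin_le_nhds hW
  have hall := hW'.and (hQne.and (hE1.and hE2))
  obtain ⟨r, hr, hr2⟩ := Metric.mem_nhdsWithin_iff.1 hall
  have hωn : ∀ z, ‖ω z‖ = 1 / (‖(p : ℂ) * a‖ * ‖z - z0‖ ^ p) := by
    intro z; simp only [hω]; rw [norm_div, norm_mul, norm_neg, norm_one, norm_pow]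
  have hω0 : ∀ z, ω z ≠ 0 → z ≠ z0 := by
    rintro z h rfl; apply h; simp [hω, hp]
  -- smallness of `z - z0` from largeness of `ω z`
  have hsmall : ∀ ε > 0, ∃ C > 0, ∀ z, C < ‖ω z‖ → z ≠ z0 ∧ ‖z - z0‖ < ε := by
    intro ε hε
    refine ⟨1 / (‖(p : ℂ) * a‖ * ε ^ p), by positivity, fun z hz => ?_⟩
    have hz0 : z ≠ z0 := hω0 z (by
      intro h; rw [h, norm_zero] at hz
      have : (0:ℝ) < 1 / (‖(p : ℂ) * a‖ * ε ^ p) := by positivity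
      linarith)
    refine ⟨hz0, ?_⟩
    by_contra hcon
    push Not at hcon
    rw [hωn] at hz
    have : 1 / (‖(p : ℂ) * a‖ * ‖z - z0‖ ^ p) ≤ 1 / (‖(p : ℂ) * a‖ * ε ^ p) := by gcongr
    linarith
  obtain ⟨C0, hC0, hC0'⟩ := hsmall r hr
  set C := max C0 6 with hC
  have hC6 : 6 ≤ C := le_max_right _ _
  have hlow : ∀ z, C < (ω z).re → z ≠ z0 ∧ z ∈ W ∧ Q z ≠ z0 ∧ ‖ω (Q z) - ω z - 1‖ ≤ 1 / 2 ∧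
      ‖ω z * (1 - deriv Q z * (z - z0) / (Q z - z0)) - 1‖ ≤ 1 / 12 := by
    intro z hz
    have h1 : C0 < ‖ω z‖ := (le_max_left _ _).trans_lt (hz.trans_le (Complex.re_le_norm _))
    obtain ⟨h2, h3⟩ := hC0' z h1
    exact ⟨h2, hr2 ⟨by rwa [mem_ball, dist_eq_norm], h2⟩⟩
  set U : Set ℂ := {z | C < (ω z).re} with hU
  have hstep : ∀ z ∈ U, (ω z).re + 1 / 2 ≤ (ω (Q z)).re := by
    intro z hz
    have h1 := (hlow z hz).2.2.2.1
    have h2 := (Complex.abs_re_le_norm _).trans h1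
    simp only [Complex.sub_re, Complex.one_re] at h2
    have := (abs_le.1 h2).1
    linarith
  have hmaps : MapsTo Q U U := fun z hz => by
    have := hstep z hz
    have hz' : C < (ω z).re := hz
    change C < (ω (Q z)).re
    linarith
  have hiter : ∀ z ∈ U, ∀ k : ℕ, (ω z).re + k / 2 ≤ (ω (Q^[k] z)).re := by
    intro z hz k
    induction k with
    | zero => simp
    | succ k ih =>
      rw [Function.iterate_succ_apply']
      have := hstep _ (hmaps.iterate k hz)
      push_cast
      linarith
  have hUo : IsOpen U := by
    rw [isOpen_iff_mem_nhds]
    intro z hz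
    have hne0 : z - z0 ≠ 0 := sub_ne_zero.2 (hlow z hz).1
    have hc : ContinuousAt (fun z => (ω z).re) z := by
      have : ContinuousAt ω z := by
        simp only [hω]
        exact ContinuousAt.div (by fun_prop) (by fun_prop) (mul_ne_zero hpa (pow_ne_zero _ hne0))
      exact Complex.continuous_re.continuousAt.comp this
    exact hc.eventually (lt_mem_nhds hz)
  have hconv : ∀ z ∈ U, Tendsto (fun k => Q^[k] z) atTop (𝓝 z0) := by
    intro z hz
    rw [Metric.tendsto_atTop]
    intro ε hε
    obtain ⟨D, hD, hD'⟩ := hsmall ε hε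
    obtain ⟨N, hN⟩ := exists_nat_gt (2 * D)
    refine ⟨N, fun k hk => ?_⟩
    rw [dist_eq_norm]
    refine (hD' _ ?_).2
    have h1 := hiter z hz k
    have h2 := Complex.re_le_norm (ω (Q^[k] z))
    have hz' : C < (ω z).re := hz
    have : (N : ℝ) ≤ k := by exact_mod_cast hk
    linarith
  -- starting point
  set T : ℝ := 2 * C + 1 with hT
  have hTpos : 0 < T := by linarith
  obtain ⟨d, hd⟩ := IsAlgClosed.exists_pow_nat_eq (-1 / (p * a * T) : ℂ) (Nat.pos_of_ne_zero hp)
  have hTc : (T : ℂ) ≠ 0 := by exact_mod_cast hTpos.ne'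
  set u := z0 + d with hu
  have hωu : ω u = T := by
    simp only [hω, hu, add_sub_cancel_left, hd]
    field_simp
  have huU : u ∈ U := by
    change C < (ω u).re
    rw [hωu, Complex.ofReal_re]; linarith
  have hre : ∀ k : ℕ, T + k / 2 ≤ (ω (Q^[k] u)).re := by
    intro k
    have := hiter u huU k
    rwa [hωu, Complex.ofReal_re] at this
  have hno : ∀ k : ℕ, ‖ω (Q^[k] u)‖ ≤ T + 3 * k / 2 := by
    intro k
    induction k with
    | zero => simp [hωu, abs_of_pos hTpos]
    | succ k ih =>
      rw [Function.iterate_succ_apply']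
      have h1 := (hlow _ (hmaps.iterate k huU)).2.2.2.1
      set w := Q^[k] u
      have h2 : ω (Q w) = (ω (Q w) - ω w - 1) + ω w + 1 := by ring
      rw [h2]
      have h3 := norm_add_le ((ω (Q w) - ω w - 1) + ω w) 1
      have h4 := norm_add_le (ω (Q w) - ω w - 1) (ω w)
      rw [norm_one] at h3
      push_cast
      linarith
  have h3k : ∀ k : ℕ, ‖ω (Q^[k] u)‖ ≤ 3 * (ω (Q^[k] u)).re := by
    intro k
    have := hre k
    have := hno k
    have : (0:ℝ) ≤ k := k.cast_nonneg
    linarith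
  have hxne : ∀ k : ℕ, Q^[k] u - z0 ≠ 0 := fun k =>
    sub_ne_zero.2 (hlow _ (hmaps.iterate k huU)).1
  -- factors
  set q : ℕ → ℝ := fun j => ‖deriv Q (Q^[j] u)‖ * ‖Q^[j] u - z0‖ / ‖Q^[j+1] u - z0‖ with hq
  have hqle : ∀ j : ℕ, q j ≤ 1 - 1 / (6 * (T + 2)) * (1 / ((j : ℝ) + 1)) := by
    intro j
    have h1 := (hlow _ (hmaps.iterate j huU)).2.2.2.2
    have h2 : 6 ≤ ‖ω (Q^[j] u)‖ := by
      have h5 := hre j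
      have h6 := Complex.re_le_norm (ω (Q^[j] u))
      have : (0:ℝ) ≤ j := j.cast_nonneg
      linarith
    have h4 := parabolic_factor (h3k j) h2 h1
    have hω0 : ω (Q^[j] u) ≠ 0 := by
      intro h; rw [h, norm_zero] at h2; linarith
    rw [mul_div_cancel_left₀ _ hω0, sub_sub_cancel, norm_div, norm_mul,
      ← Function.iterate_succ_apply' Q] at h4
    refine h4.trans ?_
    have h5 := hno j
    have h7 : 6 * ‖ω (Q^[j] u)‖ ≤ 6 * (T + 2) * ((j : ℝ) + 1) := by
      have : (0:ℝ) ≤ j := j.cast_nonneg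
      nlinarith
    have h8 : 1 / (6 * (T + 2) * ((j : ℝ) + 1)) ≤ 1 / (6 * ‖ω (Q^[j] u)‖) := by
      gcongr
    have h9 : 1 / (6 * (T + 2)) * (1 / ((j : ℝ) + 1)) = 1 / (6 * (T + 2) * ((j : ℝ) + 1)) := by
      field_simp
    rw [h9]; linarith
  have hqz := prod_to_zero (1 / (6 * (T + 2))) (by positivity) q (fun j => by positivity) hqle
  have hprod : ∀ k, ∏ j ∈ Finset.range k, ‖deriv Q (Q^[j] u)‖ =
      (∏ j ∈ Finset.range k, q j) * (‖Q^[k] u - z0‖ / ‖u - z0‖) := by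
    intro k
    induction k with
    | zero =>
      have : ‖u - z0‖ ≠ 0 := norm_ne_zero_iff.2 (hxne 0)
      simp [this]
    | succ k ih =>
      rw [Finset.prod_range_succ, Finset.prod_range_succ, ih]
      have h1 : ‖u - z0‖ ≠ 0 := norm_ne_zero_iff.2 (hxne 0)
      have h2 : ‖Q^[k] u - z0‖ ≠ 0 := norm_ne_zero_iff.2 (hxne k)
      have h3 : ‖Q^[k+1] u - z0‖ ≠ 0 := norm_ne_zero_iff.2 (hxne (k+1))
      simp only [hq]
      field_simp
  -- the radius constant
  obtain ⟨c, hc, hc2⟩ : ∃ c > 0, ∀ t : ℂ, ‖t‖ < c → 1 + t ≠ 0 ∧ ‖((1 + t) ^ p)⁻¹ - 1‖ < 1 / 6 := by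
    have h1 : ContinuousAt (fun t : ℂ => ((1 + t) ^ p)⁻¹ - 1) 0 :=
      ContinuousAt.sub (ContinuousAt.inv₀ (by fun_prop) (by simp)) (by fun_prop)
    have h2 : ∀ᶠ t : ℂ in 𝓝 0, ‖((1 + t) ^ p)⁻¹ - 1‖ < 1 / 6 := by
      have := Metric.tendsto_nhds.1 h1.tendsto (1 / 6) (by norm_num)
      simpa [dist_eq_norm] using this
    have h3 : ∀ᶠ t : ℂ in 𝓝 0, 1 + t ≠ 0 := by
      have : ContinuousAt (fun t : ℂ => 1 + t) 0 := by fun_prop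
      exact this.eventually_ne (by simp)
    obtain ⟨c, hc, hc2⟩ := Metric.mem_nhds_iff.1 (h3.and h2)
    exact ⟨c, hc, fun t ht => hc2 (by simpa [mem_ball, dist_eq_norm] using ht)⟩
  refine ⟨U, fun z hz => (hlow z hz).2.1, hUo, hmaps, hconv, u, huU,
    fun k => c * ‖Q^[k] u - z0‖, fun k => mul_pos hc (norm_pos_iff.2 (hxne k)), ?_, ?_⟩
  · intro k y hy
    rw [mem_ball, dist_eq_norm] at hy
    set x := Q^[k] u with hx
    have hx0 : x - z0 ≠ 0 := hxne k
    obtain ⟨h1, h2⟩ := hc2 ((y - x) / (x - z0)) (by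
      rw [norm_div, div_lt_iff₀ (norm_pos_iff.2 hx0)]; exact hy)
    set t := (y - x) / (x - z0) with ht
    have hyt : y - z0 = (x - z0) * (1 + t) := by rw [ht]; field_simp; ring
    have h4 : ω y = ω x + ω x * (((1 + t) ^ p)⁻¹ - 1) := by
      simp only [hω]
      rw [hyt, mul_pow]
      field_simp
      ring
    change C < (ω y).re
    rw [h4, Complex.add_re]
    have h5 := (abs_le.1 (Complex.abs_re_le_norm (ω x * (((1 + t) ^ p)⁻¹ - 1)))).1
    rw [norm_mul] at h5
    have h6 := h3k k
    have h7 := hre k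
    rw [← hx] at h6 h7
    have h8 : ‖ω x‖ * ‖((1 + t) ^ p)⁻¹ - 1‖ ≤ ‖ω x‖ * (1 / 6) := by gcongr
    have : (0:ℝ) ≤ k := k.cast_nonneg
    linarith
  · have h1 : Tendsto (fun k => (∏ j ∈ Finset.range k, q j) * (1 / (c * ‖u - z0‖))) atTop (𝓝 0) := by
      simpa using hqz.mul_const (1 / (c * ‖u - z0‖))
    refine h1.congr fun k => ?_
    rw [hprod]
    have h1 : ‖u - z0‖ ≠ 0 := norm_ne_zero_iff.2 (hxne 0)
    have h2 : ‖Q^[k] u - z0‖ ≠ 0 := norm_ne_zero_iff.2 (hxne k)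
    field_simp

lemma germ (Q : ℂ → ℂ) (z0 : ℂ) (han : AnalyticAt ℂ Q z0) (hfix : Q z0 = z0)
    (hder : ‖deriv Q z0‖ < 1 ∨ deriv Q z0 = 1) (hne : ¬ ∀ᶠ z in 𝓝 z0, Q z = z)
    (W : Set ℂ) (hW : W ∈ 𝓝 z0) :
    ∃ U ⊆ W, IsOpen U ∧ MapsTo Q U U ∧ (∀ z ∈ U, Tendsto (fun k => Q^[k] z) atTop (𝓝 z0)) ∧
      ∃ u ∈ U, ∃ ρ : ℕ → ℝ, (∀ k, 0 < ρ k) ∧ (∀ k, ball (Q^[k] u) (ρ k) ⊆ U) ∧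
      Tendsto (fun k => (∏ j ∈ Finset.range k, ‖deriv Q (Q^[j] u)‖) / ρ k) atTop (𝓝 0) := by
  rcases hder with h | h
  · exact germ_attracting Q z0 han.differentiableAt hfix h W hW
  · exact germ_parabolic Q z0 han hfix h hne W hW

end KN


namespace KN
open Set Filter Topology Metric ComplexConjugate

/-- The anti-holomorphic map `w ↦ conj (P w / E w)`. -/
noncomputable def GG (P E : ℂ → ℂ) (w : ℂ) : ℂ := conj (P w / E w)

lemma GG_hasDerivAt {P E : ℂ → ℂ} (hP : Differentiable ℂ P) (hE : Differentiable ℂ E) {w : ℂ}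
    (h1 : E w ≠ 0) (h2 : E (GG P E w) ≠ 0) :
    HasDerivAt (fun x => GG P E (GG P E x))
      (conj (deriv (fun x => P x / E x) (GG P E w)) * deriv (fun x => P x / E x) w) w := by
  have hf1 : HasDerivAt (fun x => P x / E x) (deriv (fun x => P x / E x) w) w :=
    ((hP w).div (hE w) h1).hasDerivAt
  have hf2 : HasDerivAt (fun x => P x / E x) (deriv (fun x => P x / E x) (GG P E w)) (GG P E w) :=
    ((hP _).div (hE _) h2).hasDerivAt
  have h3 := hf2.star_conj
  have h4 : conj (GG P E w) = (fun x => P x / E x) w := by simp [GG]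
  rw [h4] at h3
  have h5 := HasDerivAt.comp (h₂ := star ∘ (fun x => P x / E x) ∘ ⇑(starRingEnd ℂ)) w h3 hf1
  exact h5

lemma GG_continuousAt {P E : ℂ → ℂ} (hP : Differentiable ℂ P) (hE : Differentiable ℂ E) {w : ℂ}
    (h1 : E w ≠ 0) : ContinuousAt (GG P E) w :=
  Complex.continuous_conj.continuousAt.comp ((hP w).continuousAt.div (hE w).continuousAt h1)

lemma tendsto_even_odd {a : ℕ → ℂ} {l : ℂ} (h0 : Tendsto (fun k => a (2 * k)) atTop (𝓝 l))
    (h1 : Tendsto (fun k => a (2 * k + 1)) atTop (𝓝 l)) : Tendsto a atTop (𝓝 l) := by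
  rw [Filter.tendsto_atTop'] at h0 h1 ⊢
  intro s hs
  obtain ⟨A, hA⟩ := h0 s hs
  obtain ⟨B, hB⟩ := h1 s hs
  refine ⟨2 * A + 2 * B + 2, fun n hn => ?_⟩
  rcases Nat.even_or_odd' n with ⟨k, rfl | rfl⟩
  · exact hA k (by omega)
  · exact hB k (by omega)

lemma local_basin (P E : ℂ → ℂ) (hP : Differentiable ℂ P) (hE : Differentiable ℂ E) (w0 : ℂ)
    (hE0 : E w0 ≠ 0) (hfix : GG P E w0 = w0) (hder : ‖deriv (fun x => P x / E x) w0‖ ≤ 1)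
    (hne : ¬ ∀ᶠ w in 𝓝 w0, GG P E (GG P E w) = w) :
    ∃ U : Set ℂ, IsOpen U ∧ MapsTo (fun x => GG P E (GG P E x)) U U ∧
      (∀ w ∈ U, (∀ j, E ((GG P E)^[j] w) ≠ 0) ∧
        Tendsto (fun k => (GG P E)^[k] w) atTop (𝓝 w0)) ∧
      ∃ u ∈ U, ∃ ρ : ℕ → ℝ, (∀ k, 0 < ρ k) ∧
        (∀ k, ball ((fun x => GG P E (GG P E x))^[k] u) (ρ k) ⊆ U) ∧
        Tendsto (fun k => (∏ j ∈ Finset.range k,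
          ‖deriv (fun x => GG P E (GG P E x)) ((fun x => GG P E (GG P E x))^[j] u)‖) / ρ k)
          atTop (𝓝 0) := by
  set G := GG P E with hG
  have hcont : ContinuousAt G w0 := GG_continuousAt hP hE hE0
  have hEc : Continuous E := hE.continuous
  have hn1 : ∀ᶠ w in 𝓝 w0, E w ≠ 0 := hEc.continuousAt.eventually_ne hE0
  have hn2 : ∀ᶠ w in 𝓝 w0, E (G w) ≠ 0 := by
    have : Tendsto G (𝓝 w0) (𝓝 w0) := by simpa [ContinuousAt, hfix] using hcont
    exact this.eventually hn1
  have hW := hn1.and hn2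
  have han : AnalyticAt ℂ (fun x => G (G x)) w0 := by
    rw [Complex.analyticAt_iff_eventually_differentiableAt]
    filter_upwards [hW] with w hw
    exact (GG_hasDerivAt hP hE hw.1 hw.2).differentiableAt
  have hd : deriv (fun x => G (G x)) w0
      = ((‖deriv (fun x => P x / E x) w0‖ ^ 2 : ℝ) : ℂ) := by
    rw [(GG_hasDerivAt hP hE hE0 (by rw [← hG, hfix]; exact hE0)).deriv, ← hG, hfix]
    rw [Complex.conj_mul']
    push_cast; rfl
  obtain ⟨U, hUW, hUo, hUm, hUt, u, hu, ρ, hρ, hb, hlim⟩ := germ (fun x => G (G x)) w0 han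
    (by simp [hfix]) (by
      rw [hd]
      rcases hder.lt_or_eq with h | h
      · left
        rw [Complex.norm_real, Real.norm_of_nonneg (by positivity)]
        nlinarith [norm_nonneg (deriv (fun x => P x / E x) w0)]
      · right; rw [h]; simp) hne _ hW
  refine ⟨U, hUo, hUm, ?_, u, hu, ρ, hρ, hb, hlim⟩
  intro w hw
  have hev : ∀ k, G^[2 * k] w = (fun x => G (G x))^[k] w := by
    intro k; rw [Function.iterate_mul]; rfl
  have hin : ∀ k, G^[2 * k] w ∈ U := by
    intro k; rw [hev]; exact hUm.iterate k hw
  refine ⟨fun j => ?_, ?_⟩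
  · rcases Nat.even_or_odd' j with ⟨k, rfl | rfl⟩
    · exact (hUW (hin k)).1
    · rw [Function.iterate_succ_apply']; exact (hUW (hin k)).2
  · have h0 : Tendsto (fun k => G^[2 * k] w) atTop (𝓝 w0) := by
      simp_rw [hev]; exact hUt w hw
    refine tendsto_even_odd h0 ?_
    simp_rw [Function.iterate_succ_apply']
    have : Tendsto G (𝓝 w0) (𝓝 w0) := by simpa [ContinuousAt, hfix] using hcont
    exact this.comp h0

/-- Preimages of compact sets are closed if `P`, `E` have no common zero. -/
lemma closed_preimage (P E : ℂ → ℂ) (hP : Continuous P) (hE : Continuous E)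
    (hcz : ∀ w, E w = 0 → P w ≠ 0) {K : Set ℂ} (hK : IsCompact K) :
    IsClosed {w | E w ≠ 0 ∧ GG P E w ∈ K} := by
  have : {w | E w ≠ 0 ∧ GG P E w ∈ K}
      = Prod.fst '' {p : ℂ × K | P p.1 = E p.1 * conj (p.2 : ℂ)} := by
    ext w
    constructor
    · rintro ⟨h1, h2⟩
      refine ⟨⟨w, ⟨_, h2⟩⟩, ?_, rfl⟩
      simp only [mem_ofPred_eq, GG, Complex.conj_conj]
      field_simp
    · rintro ⟨⟨w', κ⟩, h, rfl⟩
      simp only [mem_ofPred_eq] at h ⊢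
      have hEw : E w' ≠ 0 := by
        intro h0
        apply hcz _ h0
        rw [h, h0, zero_mul]
      refine ⟨hEw, ?_⟩
      have : GG P E w' = κ := by
        rw [GG, h, mul_div_cancel_left₀ _ hEw, Complex.conj_conj]
      rw [this]; exact κ.2
  rw [this]
  have : CompactSpace K := isCompact_iff_compactSpace.mp hK
  apply isClosedMap_fst_of_compactSpace
  apply isClosed_eq
  · fun_prop
  · have := Complex.continuous_conj
    exact (hE.comp continuous_fst).mul (this.comp (continuous_subtype_val.comp continuous_snd))

theorem fatou (P E : ℂ → ℂ) (hP : Differentiable ℂ P) (hE : Differentiable ℂ E)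
    (hcz : ∀ w, E w = 0 → P w ≠ 0) (w0 : ℂ)
    (hE0 : E w0 ≠ 0) (hfix : GG P E w0 = w0) (hder : ‖deriv (fun x => P x / E x) w0‖ ≤ 1)
    (hne : ¬ ∀ᶠ w in 𝓝 w0, GG P E (GG P E w) = w)
    (M : ℝ) (hM : ∀ w, (∀ j, E ((GG P E)^[j] w) ≠ 0) →
      Tendsto (fun k => (GG P E)^[k] w) atTop (𝓝 w0) → ‖w‖ ≤ M) :
    ∃ c, deriv (fun x => P x / E x) c = 0 ∧ (∀ j, E ((GG P E)^[j] c) ≠ 0) ∧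
      Tendsto (fun k => (GG P E)^[k] c) atTop (𝓝 w0) := by
  obtain ⟨U, hUo, hUm, hUt, u, hu, ρ, hρ, hb, hlim⟩ := local_basin P E hP hE w0 hE0 hfix hder hne
  set G := GG P E with hG
  -- the basin
  let Bk : ℕ → Set ℂ := fun k => Nat.rec U (fun _ S => {w | E w ≠ 0 ∧ G w ∈ S}) k
  have hBk0 : Bk 0 = U := rfl
  have hBks : ∀ k, Bk (k + 1) = {w | E w ≠ 0 ∧ G w ∈ Bk k} := fun k => rfl
  have hBo : ∀ k, IsOpen (Bk k) := by
    intro k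
    induction k with
    | zero => exact hUo
    | succ k ih =>
      rw [hBks, isOpen_iff_mem_nhds]
      rintro w ⟨h1, h2⟩
      have e1 : ∀ᶠ x in 𝓝 w, E x ≠ 0 := hE.continuous.continuousAt.eventually_ne h1
      have e2 : ∀ᶠ x in 𝓝 w, G x ∈ Bk k := (GG_continuousAt hP hE h1) (ih.mem_nhds h2)
      exact e1.and e2
  have hBt : ∀ k, ∀ w ∈ Bk k, (∀ j, E (G^[j] w) ≠ 0) ∧
      Tendsto (fun k => G^[k] w) atTop (𝓝 w0) := by
    intro k
    induction k with
    | zero => exact hUt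
    | succ k ih =>
      rintro w ⟨h1, h2⟩
      obtain ⟨h3, h4⟩ := ih _ h2
      refine ⟨fun j => ?_, ?_⟩
      · cases j with
        | zero => exact h1
        | succ j => rw [Function.iterate_succ_apply]; exact h3 j
      · rw [← tendsto_add_atTop_iff_nat 1]
        simpa only [Function.iterate_succ_apply] using h4
  let B : Set ℂ := ⋃ k, Bk k
  have hBopen : IsOpen B := isOpen_iUnion hBo
  have hBtt : ∀ w ∈ B, (∀ j, E (G^[j] w) ≠ 0) ∧
      Tendsto (fun k => G^[k] w) atTop (𝓝 w0) := by
    intro w hw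
    obtain ⟨k, hk⟩ := mem_iUnion.1 hw
    exact hBt k w hk
  have hpull : ∀ w, E w ≠ 0 → G w ∈ B → w ∈ B := by
    intro w h1 h2
    obtain ⟨k, hk⟩ := mem_iUnion.1 h2
    exact mem_iUnion.2 ⟨k + 1, h1, hk⟩
  have hUB : U ⊆ B := fun w hw => mem_iUnion.2 ⟨0, hw⟩
  have hEB : ∀ w ∈ B, E w ≠ 0 := fun w hw => (hBtt w hw).1 0
  have hGB : MapsTo G B B := by
    intro w hw
    obtain ⟨k, hk⟩ := mem_iUnion.1 hw
    cases k with
    | zero =>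
      apply hpull _ ((hBtt w hw).1 1)
      exact hUB (hUm hk)
    | succ k => exact mem_iUnion.2 ⟨k, hk.2⟩
  by_contra hcon
  push Not at hcon
  have hcrit : ∀ w ∈ B, deriv (fun x => P x / E x) w ≠ 0 := fun w hw h0 =>
    hcon w h0 (hBtt w hw).1 (hBtt w hw).2
  have hBM : ∀ w ∈ B, ‖w‖ ≤ M := fun w hw => hM w (hBtt w hw).1 (hBtt w hw).2
  have hprop1 : ∀ K ⊆ B, IsCompact K → IsCompact (B ∩ G ⁻¹' K) := by
    intro K hKB hK
    have h1 : B ∩ G ⁻¹' K = {w | E w ≠ 0 ∧ GG P E w ∈ K} := by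
      ext w
      constructor
      · rintro ⟨h1, h2⟩; exact ⟨hEB w h1, h2⟩
      · rintro ⟨h1, h2⟩; exact ⟨hpull w h1 (hKB h2), h2⟩
    have h2 := closed_preimage P E hP.continuous hE.continuous hcz hK
    rw [← h1] at h2
    refine Metric.isCompact_of_isClosed_isBounded h2 ?_
    refine (Metric.isBounded_closedBall (x := (0:ℂ)) (r := M)).subset ?_
    intro w hw
    simpa using hBM w hw.1
  have hQd : ∀ w ∈ B, HasDerivAt (fun x => G (G x))
      (conj (deriv (fun x => P x / E x) (G w)) * deriv (fun x => P x / E x) w) w := fun w hw =>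
    GG_hasDerivAt hP hE (hEB w hw) (hEB _ (hGB hw))
  have key := fun k => lift_bound B hBopen M hBM (fun x => G (G x))
    (fun w hw => (hQd w hw).differentiableAt.differentiableWithinAt)
    (fun w hw => hGB (hGB hw))
    (by
      intro K hKB hK
      have := hprop1 _ inter_subset_left (hprop1 K hKB hK)
      convert this using 1
      ext w
      constructor
      · rintro ⟨h1, h2⟩; exact ⟨h1, hGB h1, h2⟩
      · rintro ⟨h1, h2, h3⟩; exact ⟨h1, h3⟩)
    (by
      intro w hw
      rw [(hQd w hw).deriv]
      exact mul_ne_zero ((map_ne_zero _).2 (hcrit _ (hGB hw))) (hcrit w hw))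
    u (hUB hu) k (ρ k) (hρ k) ((hb k).trans hUB)
  have hlim2 := hlim.const_mul (2 * M + 1)
  rw [mul_zero] at hlim2
  have : (1:ℝ) ≤ 0 := by
    refine ge_of_tendsto' hlim2 (fun k => ?_)
    rw [← mul_div_assoc, le_div_iff₀ (hρ k), one_mul]
    exact key k
  linarith

end KN


namespace KN
open Set Filter Topology Metric ComplexConjugate

noncomputable def r0 {n : ℕ} (z : Fin n → ℂ) (m : Fin n → ℝ) (x : ℂ) : ℂ :=
  ∑ j, (m j : ℂ) / (x - z j)

noncomputable def dr {n : ℕ} (z : Fin n → ℂ) (m : Fin n → ℝ) (x : ℂ) : ℂ :=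
  - ∑ j, (m j : ℂ) / (x - z j) ^ 2

lemma r0_hasDerivAt {n : ℕ} (z : Fin n → ℂ) (m : Fin n → ℝ) {x : ℂ} (hx : ∀ j, x ≠ z j) :
    HasDerivAt (r0 z m) (dr z m x) x := by
  have : HasDerivAt (fun x => ∑ j, (m j : ℂ) / (x - z j)) (∑ j, -((m j : ℂ) / (x - z j) ^ 2)) x := by
    apply HasDerivAt.fun_sum
    intro j _
    have h := (((hasDerivAt_id x).sub_const (z j)).fun_inv (sub_ne_zero.2 (hx j))).const_mul (m j : ℂ)
    simp only [div_eq_mul_inv (m j : ℂ)]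
    refine h.congr_deriv ?_
    simp only [id]; ring
  simp only [Finset.sum_neg_distrib] at this
  exact this

lemma sumprod {n : ℕ} (a L : Fin n → ℂ) (hL : ∀ k, L k ≠ 0) :
    ∑ j, a j * ∏ k ∈ Finset.univ.erase j, L k = (∏ k, L k) * ∑ j, a j / L j := by
  rw [Finset.mul_sum]
  refine Finset.sum_congr rfl fun j _ => ?_
  rw [← Finset.mul_prod_erase Finset.univ L (Finset.mem_univ j)]
  field_simp [hL j]

noncomputable def D0 {n : ℕ} (z : Fin n → ℂ) (x : ℂ) : ℂ := ∏ k, (x - z k)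

noncomputable def PP {n : ℕ} (z : Fin n → ℂ) (m : Fin n → ℝ) (x : ℂ) : ℂ :=
  ∑ j, (m j : ℂ) * ∏ k ∈ Finset.univ.erase j, (x - z k)

noncomputable def P1 {n : ℕ} (z : Fin n → ℂ) (m : Fin n → ℝ) (ζ : ℂ) (x : ℂ) : ℂ :=
  conj ζ * D0 z x + PP z m x

lemma D0_ne {n : ℕ} {z : Fin n → ℂ} {x : ℂ} : D0 z x ≠ 0 ↔ ∀ j, x ≠ z j := by
  simp [D0, Finset.prod_ne_zero_iff, sub_ne_zero]

lemma PP_eq {n : ℕ} {z : Fin n → ℂ} (m : Fin n → ℝ) {x : ℂ} (hx : ∀ j, x ≠ z j) :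
    PP z m x = D0 z x * r0 z m x :=
  sumprod (fun j => (m j : ℂ)) (fun k => x - z k) (fun k => sub_ne_zero.2 (hx k))

lemma PP_pole {n : ℕ} {z : Fin n → ℂ} (hz : Function.Injective z) {m : Fin n → ℝ}
    (hm : ∀ j, 0 < m j) (i : Fin n) : PP z m (z i) ≠ 0 := by
  have : PP z m (z i) = (m i : ℂ) * ∏ k ∈ Finset.univ.erase i, (z i - z k) := by
    apply Finset.sum_eq_single i
    · intro j _ hj
      rw [Finset.prod_eq_zero (i := i) (by simp [hj.symm]) (by simp), mul_zero]
    · simp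
  rw [this]
  refine mul_ne_zero (by exact_mod_cast (hm i).ne') (Finset.prod_ne_zero_iff.2 fun k hk => ?_)
  rw [sub_ne_zero]
  intro h
  exact (Finset.ne_of_mem_erase hk) (hz h).symm

lemma P1_div {n : ℕ} {z : Fin n → ℂ} (m : Fin n → ℝ) (ζ : ℂ) {x : ℂ} (hx : ∀ j, x ≠ z j) :
    P1 z m ζ x / D0 z x = conj ζ + r0 z m x := by
  have h := D0_ne.2 hx
  rw [P1, PP_eq m hx]; field_simp

lemma GG1_eq {n : ℕ} {z : Fin n → ℂ} (m : Fin n → ℝ) (ζ : ℂ) {x : ℂ} (hx : ∀ j, x ≠ z j) :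
    GG (P1 z m ζ) (D0 z) x = ζ + conj (r0 z m x) := by
  rw [GG, P1_div m ζ hx]; simp

lemma D0_diff {n : ℕ} (z : Fin n → ℂ) : Differentiable ℂ (D0 z) := by
  unfold D0; fun_prop

lemma PP_diff {n : ℕ} (z : Fin n → ℂ) (m : Fin n → ℝ) : Differentiable ℂ (PP z m) := by
  unfold PP; fun_prop

lemma P1_diff {n : ℕ} (z : Fin n → ℂ) (m : Fin n → ℝ) (ζ : ℂ) : Differentiable ℂ (P1 z m ζ) := by
  have h1 := D0_diff z
  have h2 := PP_diff z m
  unfold P1; fun_prop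

lemma eventually_nonpole {n : ℕ} (z : Fin n → ℂ) {x : ℂ} (hx : ∀ j, x ≠ z j) :
    ∀ᶠ y in 𝓝 x, ∀ j, y ≠ z j := by
  rw [eventually_all]
  exact fun j => eventually_ne_nhds (hx j)

lemma deriv_P1_div {n : ℕ} {z : Fin n → ℂ} (m : Fin n → ℝ) (ζ : ℂ) {x : ℂ} (hx : ∀ j, x ≠ z j) :
    deriv (fun x => P1 z m ζ x / D0 z x) x = dr z m x := by
  have h : (fun x => P1 z m ζ x / D0 z x) =ᶠ[𝓝 x] fun x => conj ζ + r0 z m x := by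
    filter_upwards [eventually_nonpole z hx] with y hy using P1_div m ζ hy
  rw [h.deriv_eq]
  exact ((r0_hasDerivAt z m hx).const_add _).deriv

lemma nonid {n : ℕ} (hn : 2 ≤ n) {z : Fin n → ℂ} (hz : Function.Injective z) {m : Fin n → ℝ}
    (hm : ∀ j, 0 < m j) (ζ z0 : ℂ) (h0 : ∀ j, z0 ≠ z j) (hfix : ζ + conj (r0 z m z0) = z0) :
    ¬ ∀ᶠ x in 𝓝 z0, GG (P1 z m ζ) (D0 z) (GG (P1 z m ζ) (D0 z) x) = x := by
  intro hid
  let A : Fin n → ℂ → ℂ := fun j x => D0 z x * conj (ζ - z j) + PP z m x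
  have hA : ∀ j, Differentiable ℂ (A j) := by
    intro j
    have h1 := D0_diff z
    have h2 := PP_diff z m
    simp only [A]; fun_prop
  let f : ℂ → ℂ := fun x => (x - ζ) * ∏ j, A j x
  let g : ℂ → ℂ := fun x => D0 z x * ∑ j, (m j : ℂ) * ∏ k ∈ Finset.univ.erase j, A k x
  have hf : Differentiable ℂ f := by simp only [f]; fun_prop
  have hg : Differentiable ℂ g := by have := D0_diff z; simp only [g]; fun_prop
  have hcont : ContinuousAt (GG (P1 z m ζ) (D0 z)) z0 :=
    GG_continuousAt (P1_diff z m ζ) (D0_diff z) (D0_ne.2 h0)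
  have hfix' : GG (P1 z m ζ) (D0 z) z0 = z0 := by rw [GG1_eq m ζ h0, hfix]
  have ht : Tendsto (GG (P1 z m ζ) (D0 z)) (𝓝 z0) (𝓝 z0) := by
    simpa [ContinuousAt, hfix'] using hcont
  have hev : f =ᶠ[𝓝 z0] g := by
    filter_upwards [hid, eventually_nonpole z h0, ht.eventually (eventually_nonpole z h0)]
      with x hx h1 h2
    rw [GG1_eq m ζ h2] at hx
    rw [GG1_eq m ζ h1] at hx h2
    have hAe : ∀ j, A j x = D0 z x * conj (ζ + conj (r0 z m x) - z j) := by
      intro j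
      simp only [A, PP_eq m h1, map_sub, map_add, Complex.conj_conj]; ring
    have hD := D0_ne.2 h1
    have hAn : ∀ j, A j x ≠ 0 := by
      intro j
      rw [hAe]
      exact mul_ne_zero hD ((map_ne_zero _).2 (sub_ne_zero.2 (h2 j)))
    simp only [f, g]
    rw [sumprod (fun j => (m j : ℂ)) (fun j => A j x) hAn]
    have hx2 : x - ζ = D0 z x * ∑ j, (m j : ℂ) / A j x := by
      have : D0 z x * ∑ j, (m j : ℂ) / A j x = conj (r0 z m (ζ + conj (r0 z m x))) := by
        rw [r0, map_sum, Finset.mul_sum]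
        refine Finset.sum_congr rfl fun j _ => ?_
        rw [hAe, map_div₀, Complex.conj_ofReal]
        have := (map_ne_zero (starRingEnd ℂ)).2 (sub_ne_zero.2 (h2 j))
        field_simp
      rw [this]
      linear_combination -hx
    rw [hx2]; ring
  have heq : f = g :=
    AnalyticOnNhd.eq_of_eventuallyEq (fun x _ => hf.analyticAt x) (fun x _ => hg.analyticAt x) hev
  have hall : ∀ i, z i = ζ := by
    intro i
    have h := congrFun heq (z i)
    have hD : D0 z (z i) = 0 := Finset.prod_eq_zero (Finset.mem_univ i) (by simp)
    simp only [f, g, A, hD, zero_mul, zero_add] at h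
    rcases mul_eq_zero.1 h with h | h
    · exact sub_eq_zero.1 h
    · exact absurd h (Finset.prod_ne_zero_iff.2 fun _ _ => PP_pole hz hm i)
  have h01 := hz ((hall ⟨0, by omega⟩).trans (hall ⟨1, by omega⟩).symm)
  simp at h01

/-- The map on the Riemann sphere. -/
noncomputable def Fh {n : ℕ} (z : Fin n → ℂ) (m : Fin n → ℝ) (ζ : ℂ) : OnePoint ℂ → OnePoint ℂ
  | none => ((ζ : ℂ) : OnePoint ℂ)
  | some x => open Classical in
      if ∀ j, x ≠ z j then ((ζ + conj (r0 z m x) : ℂ) : OnePoint ℂ) else OnePoint.infty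

lemma Fh_infty {n : ℕ} (z : Fin n → ℂ) (m : Fin n → ℝ) (ζ : ℂ) :
    Fh z m ζ OnePoint.infty = (ζ : OnePoint ℂ) := rfl

lemma Fh_coe {n : ℕ} {z : Fin n → ℂ} (m : Fin n → ℝ) (ζ : ℂ) {x : ℂ} (hx : ∀ j, x ≠ z j) :
    Fh z m ζ (x : OnePoint ℂ) = ((ζ + conj (r0 z m x) : ℂ) : OnePoint ℂ) := if_pos hx

lemma Fh_pole {n : ℕ} (z : Fin n → ℂ) (m : Fin n → ℝ) (ζ : ℂ) (i : Fin n) :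
    Fh z m ζ (z i : OnePoint ℂ) = OnePoint.infty := if_neg (by push Not; exact ⟨i, rfl⟩)

lemma basin_orig {n : ℕ} (hn : 2 ≤ n) {z : Fin n → ℂ} (hz : Function.Injective z) {m : Fin n → ℝ}
    (hm : ∀ j, 0 < m j) (ζ z1 : ℂ) (h1 : ∀ j, z1 ≠ z j) (hfix : ζ + conj (r0 z m z1) = z1)
    (hdr : ‖dr z m z1‖ ≤ 1) :
    ∃ V : Set ℂ, IsOpen V ∧ V.Nonempty ∧
      ∀ x ∈ V, Tendsto (fun k => (Fh z m ζ)^[k] (x : OnePoint ℂ)) atTop (𝓝 (z1 : OnePoint ℂ)) := by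
  obtain ⟨U, hUo, -, hU, u, hu, -⟩ := local_basin (P1 z m ζ) (D0 z) (P1_diff z m ζ) (D0_diff z) z1
    (D0_ne.2 h1) (by rw [GG1_eq m ζ h1, hfix]) (by rw [deriv_P1_div m ζ h1]; exact hdr)
    (nonid hn hz hm ζ z1 h1 hfix)
  refine ⟨U, hUo, ⟨u, hu⟩, fun x hx => ?_⟩
  obtain ⟨hne, ht⟩ := hU x hx
  have : ∀ k, (Fh z m ζ)^[k] (x : OnePoint ℂ)
      = (((GG (P1 z m ζ) (D0 z))^[k] x : ℂ) : OnePoint ℂ) := by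
    intro k
    induction k with
    | zero => rfl
    | succ k ih =>
      rw [Function.iterate_succ_apply', Function.iterate_succ_apply', ih,
        Fh_coe m ζ (D0_ne.1 (hne k)), GG1_eq m ζ (D0_ne.1 (hne k))]
  simp_rw [this]
  exact (OnePoint.continuous_coe.tendsto z1).comp ht


noncomputable def Lk {n : ℕ} (z : Fin n → ℂ) (b w : ℂ) (k : Fin n) : ℂ := 1 + (b - z k) * w

noncomputable def Dw {n : ℕ} (z : Fin n → ℂ) (b w : ℂ) : ℂ := ∏ k, Lk z b w k

noncomputable def Tj {n : ℕ} (z : Fin n → ℂ) (b : ℂ) (j : Fin n) (w : ℂ) : ℂ :=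
  ∏ k ∈ Finset.univ.erase j, Lk z b w k

noncomputable def Ew {n : ℕ} (z : Fin n → ℂ) (m : Fin n → ℝ) (ζ b w : ℂ) : ℂ :=
  conj (ζ - b) * Dw z b w + w * ∑ j, (m j : ℂ) * Tj z b j w

lemma Lk_diff {n : ℕ} (z : Fin n → ℂ) (b : ℂ) (k : Fin n) :
    Differentiable ℂ (fun w => Lk z b w k) := by
  unfold Lk; fun_prop

lemma Tj_diff {n : ℕ} (z : Fin n → ℂ) (b : ℂ) (j : Fin n) : Differentiable ℂ (Tj z b j) := by
  have := Lk_diff z b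
  unfold Tj; fun_prop

lemma Dw_diff {n : ℕ} (z : Fin n → ℂ) (b : ℂ) : Differentiable ℂ (Dw z b) := by
  have := Lk_diff z b
  unfold Dw; fun_prop

lemma Ew_diff {n : ℕ} (z : Fin n → ℂ) (m : Fin n → ℝ) (ζ b : ℂ) :
    Differentiable ℂ (Ew z m ζ b) := by
  have := Dw_diff z b
  have := Tj_diff z b
  unfold Ew; fun_prop

lemma deriv_w {n : ℕ} (z : Fin n → ℂ) (m : Fin n → ℝ) (ζ b w : ℂ) (hE : Ew z m ζ b w ≠ 0) :
    deriv (fun w => Dw z b w / Ew z m ζ b w) w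
      = - (∑ j, (m j : ℂ) * Tj z b j w ^ 2) / Ew z m ζ b w ^ 2 := by
  have hD := (Dw_diff z b w).hasDerivAt
  have hT := fun j => (Tj_diff z b j w).hasDerivAt
  have hS : HasDerivAt (fun w => ∑ j, (m j : ℂ) * Tj z b j w)
      (∑ j, (m j : ℂ) * deriv (Tj z b j) w) w :=
    HasDerivAt.fun_sum fun j _ => (hT j).const_mul _
  have hEE : HasDerivAt (Ew z m ζ b) (conj (ζ - b) * deriv (Dw z b) w
      + (1 * (∑ j, (m j : ℂ) * Tj z b j w) + w * ∑ j, (m j : ℂ) * deriv (Tj z b j) w)) w :=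
    (hD.const_mul _).add ((hasDerivAt_id w).mul hS)
  rw [(hD.fun_div hEE hE).deriv]
  congr 1
  have hDj : ∀ j, Dw z b w = Lk z b w j * Tj z b j w := fun j =>
    (Finset.mul_prod_erase Finset.univ _ (Finset.mem_univ j)).symm
  have hD' : ∀ j, deriv (Dw z b) w = (b - z j) * Tj z b j w + Lk z b w j * deriv (Tj z b j) w := by
    intro j
    have h1 : Dw z b = fun w => Lk z b w j * Tj z b j w := by
      funext w
      exact (Finset.mul_prod_erase Finset.univ _ (Finset.mem_univ j)).symm
    have h2 : HasDerivAt (fun w => Lk z b w j) (b - z j) w := by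
      have := ((hasDerivAt_id w).const_mul (b - z j)).const_add 1
      simpa [Lk] using this
    rw [h1]
    exact (h2.fun_mul (hT j)).deriv
  have key : w * (deriv (Dw z b) w * (∑ j, (m j : ℂ) * Tj z b j w)
      - Dw z b w * ∑ j, (m j : ℂ) * deriv (Tj z b j) w) - Dw z b w * (∑ j, (m j : ℂ) * Tj z b j w)
      = - ∑ j, (m j : ℂ) * Tj z b j w ^ 2 := by
    simp only [Finset.mul_sum, ← Finset.sum_sub_distrib, ← Finset.sum_neg_distrib]
    refine Finset.sum_congr rfl fun j _ => ?_
    rw [hD' j, hDj j, Lk]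
    ring
  rw [← key, Ew]
  ring

lemma Lk_eq {n : ℕ} (z : Fin n → ℂ) (b : ℂ) {w : ℂ} (hw : w ≠ 0) (k : Fin n) :
    Lk z b w k = w * (b + 1 / w - z k) := by
  unfold Lk; field_simp; ring

lemma Ew_eq {n : ℕ} {z : Fin n → ℂ} (m : Fin n → ℝ) (ζ b : ℂ) {w : ℂ} (hw : w ≠ 0)
    (hx : ∀ j, b + 1 / w ≠ z j) :
    Ew z m ζ b w = Dw z b w * (conj (ζ - b) + r0 z m (b + 1 / w)) ∧ Dw z b w ≠ 0 := by
  have hL : ∀ k, Lk z b w k ≠ 0 := fun k => by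
    rw [Lk_eq z b hw]; exact mul_ne_zero hw (sub_ne_zero.2 (hx k))
  have hD : Dw z b w ≠ 0 := Finset.prod_ne_zero_iff.2 fun k _ => hL k
  refine ⟨?_, hD⟩
  have : ∑ j, (m j : ℂ) * Tj z b j w = Dw z b w * ∑ j, (m j : ℂ) / Lk z b w j :=
    sumprod (fun j => (m j : ℂ)) _ hL
  rw [Ew, this, r0]
  have h2 : w * ∑ j, (m j : ℂ) / Lk z b w j = ∑ j, (m j : ℂ) / (b + 1 / w - z j) := by
    rw [Finset.mul_sum]
    refine Finset.sum_congr rfl fun j _ => ?_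
    rw [Lk_eq z b hw]
    have := sub_ne_zero.2 (hx j)
    rw [← mul_div_assoc, mul_div_mul_left _ _ hw]
  rw [← h2]; ring

end KN


namespace KN
open Set Filter Topology Metric ComplexConjugate

lemma Ew_Dw_cz {n : ℕ} {z : Fin n → ℂ} (hz : Function.Injective z) {m : Fin n → ℝ}
    (hm : ∀ j, 0 < m j) (ζ b w : ℂ) (hE : Ew z m ζ b w = 0) : Dw z b w ≠ 0 := by
  intro hD
  obtain ⟨k, -, hk⟩ := Finset.prod_eq_zero_iff.1 hD
  have hw : w ≠ 0 := by
    rintro rfl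
    simp [Lk] at hk
  have h1 : ∑ j, (m j : ℂ) * Tj z b j w = (m k : ℂ) * Tj z b k w := by
    apply Finset.sum_eq_single k
    · intro j _ hj
      rw [Tj, Finset.prod_eq_zero (i := k) (by simp [hj.symm]) hk, mul_zero]
    · simp
  rw [Ew, hD, mul_zero, zero_add, h1] at hE
  refine mul_ne_zero hw (mul_ne_zero (by exact_mod_cast (hm k).ne') ?_) hE
  refine Finset.prod_ne_zero_iff.2 fun j hj h => ?_
  apply Finset.ne_of_mem_erase hj
  apply hz
  unfold Lk at h hk
  have : (z k - z j) * w = 0 := by linear_combination h - hk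
  rcases mul_eq_zero.1 this with h | h
  · exact (sub_eq_zero.1 h).symm
  · exact absurd h hw

open Classical in
noncomputable def iw (b w : ℂ) : OnePoint ℂ :=
  if w = 0 then OnePoint.infty else ((b + 1 / w : ℂ) : OnePoint ℂ)

lemma iw_of_ne (b : ℂ) {w : ℂ} (hw : w ≠ 0) : iw b w = ((b + 1 / w : ℂ) : OnePoint ℂ) := if_neg hw

lemma GGw_eq {n : ℕ} {z : Fin n → ℂ} (m : Fin n → ℝ) (ζ b : ℂ) {w : ℂ} (hw : w ≠ 0)
    (hx : ∀ j, b + 1 / w ≠ z j) :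
    GG (Dw z b) (Ew z m ζ b) w = 1 / (ζ + conj (r0 z m (b + 1 / w)) - b) := by
  obtain ⟨h1, h2⟩ := Ew_eq m ζ b hw hx
  rw [GG, h1, div_mul_cancel_left₀ h2]
  simp only [map_inv₀, map_add, map_sub, Complex.conj_conj, one_div]
  congr 1; ring

lemma semiconj {n : ℕ} (z : Fin n → ℂ) (m : Fin n → ℝ) (ζ b w : ℂ) (hE : Ew z m ζ b w ≠ 0) :
    Fh z m ζ (iw b w) = iw b (GG (Dw z b) (Ew z m ζ b) w) := by
  by_cases hw : w = 0
  · subst hw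
    have hD : Dw z b 0 = 1 := by simp [Dw, Lk]
    have hE0 : Ew z m ζ b 0 = conj (ζ - b) := by simp [Ew, hD]
    have hne : ζ - b ≠ 0 := by
      rw [hE0] at hE
      exact (map_ne_zero _).1 hE
    have hG : GG (Dw z b) (Ew z m ζ b) 0 = 1 / (ζ - b) := by
      rw [GG, hD, hE0]; simp
    rw [hG, iw_of_ne b (one_div_ne_zero hne)]
    simp only [iw, if_true, Fh_infty]
    simp
  · by_cases hx : ∀ j, b + 1 / w ≠ z j
    · obtain ⟨h1, h2⟩ := Ew_eq m ζ b hw hx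
      rw [iw_of_ne b hw, Fh_coe m ζ hx, GGw_eq m ζ b hw hx]
      have hne : ζ + conj (r0 z m (b + 1 / w)) - b ≠ 0 := by
        intro h
        rw [h1] at hE
        apply right_ne_zero_of_mul hE
        have := congrArg conj h
        simp only [map_sub, map_add, Complex.conj_conj, map_zero] at this ⊢
        linear_combination this
      rw [iw_of_ne b (one_div_ne_zero hne)]
      congr 1
      simp
    · push Not at hx
      obtain ⟨i, hi⟩ := hx
      have hD : Dw z b w = 0 := by
        refine Finset.prod_eq_zero (Finset.mem_univ i) ?_
        rw [Lk_eq z b hw, hi]; simp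
      rw [iw_of_ne b hw, hi, Fh_pole]
      simp [GG, hD, iw]

lemma semiconj_iter {n : ℕ} (z : Fin n → ℂ) (m : Fin n → ℝ) (ζ b w : ℂ)
    (hE : ∀ j, Ew z m ζ b ((GG (Dw z b) (Ew z m ζ b))^[j] w) ≠ 0) (k : ℕ) :
    (Fh z m ζ)^[k] (iw b w) = iw b ((GG (Dw z b) (Ew z m ζ b))^[k] w) := by
  induction k with
  | zero => rfl
  | succ k ih => rw [Function.iterate_succ_apply', Function.iterate_succ_apply', ih,
      semiconj z m ζ b _ (hE k)]

lemma iw_tendsto (b : ℂ) {w0 : ℂ} (hw : w0 ≠ 0) {a : ℕ → ℂ} (ha : Tendsto a atTop (𝓝 w0)) :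
    Tendsto (fun k => iw b (a k)) atTop (𝓝 ((b + 1 / w0 : ℂ) : OnePoint ℂ)) := by
  have h1 : Tendsto (fun k => ((b + 1 / a k : ℂ) : OnePoint ℂ)) atTop
      (𝓝 ((b + 1 / w0 : ℂ) : OnePoint ℂ)) :=
    (OnePoint.continuous_coe.tendsto _).comp ((tendsto_const_nhds.div ha hw).const_add b)
  refine h1.congr' ?_
  filter_upwards [ha.eventually_ne hw] with k hk
  rw [iw_of_ne b hk]

noncomputable def NN {n : ℕ} (z : Fin n → ℂ) (m : Fin n → ℝ) (x : ℂ) : ℂ :=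
  ∑ j, (m j : ℂ) * (∏ k ∈ Finset.univ.erase j, (x - z k)) ^ 2

theorem crit_exists {n : ℕ} (hn : 2 ≤ n) {z : Fin n → ℂ} (hz : Function.Injective z) {m : Fin n → ℝ}
    (hm : ∀ j, 0 < m j) (ζ z0 z1 : ℂ) (h01 : z0 ≠ z1)
    (h0 : ∀ j, z0 ≠ z j) (hfix0 : ζ + conj (r0 z m z0) = z0) (hdr0 : ‖dr z m z0‖ ≤ 1)
    (h1 : ∀ j, z1 ≠ z j) (hfix1 : ζ + conj (r0 z m z1) = z1) (hdr1 : ‖dr z m z1‖ ≤ 1) :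
    ∃ c : ℂ, NN z m c = 0 ∧
      Tendsto (fun k => (Fh z m ζ)^[k] (c : OnePoint ℂ)) atTop (𝓝 (z0 : OnePoint ℂ)) := by
  obtain ⟨V, hVo, ⟨b, hb⟩, hV⟩ := basin_orig hn hz hm ζ z1 h1 hfix1 hdr1
  have hz0b : z0 - b ≠ 0 := by
    rw [sub_ne_zero]
    rintro rfl
    have ht := hV z0 hb
    have : ∀ k, (Fh z m ζ)^[k] (z0 : OnePoint ℂ) = (z0 : OnePoint ℂ) := by
      intro k
      apply Function.iterate_fixed
      rw [Fh_coe m ζ h0, hfix0]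
    simp_rw [this] at ht
    exact h01 (OnePoint.coe_injective (tendsto_nhds_unique tendsto_const_nhds ht))
  set w0 : ℂ := 1 / (z0 - b) with hw0
  have hw0n : w0 ≠ 0 := one_div_ne_zero hz0b
  have hx0 : b + 1 / w0 = z0 := by rw [hw0]; simp
  have hpole : ∀ j, b + 1 / w0 ≠ z j := by rw [hx0]; exact h0
  obtain ⟨hE1, hDn⟩ := Ew_eq m ζ b hw0n hpole
  have hk : conj (ζ - b) + r0 z m z0 = conj (z0 - b) := by
    conv_rhs => rw [← hfix0]
    simp only [map_sub, map_add, Complex.conj_conj]; ring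
  rw [hx0, hk] at hE1
  have hcn : conj (z0 - b) ≠ 0 := (map_ne_zero _).2 hz0b
  have hEn : Ew z m ζ b w0 ≠ 0 := by rw [hE1]; exact mul_ne_zero hDn hcn
  have hfixw : GG (Dw z b) (Ew z m ζ b) w0 = w0 := by
    rw [GGw_eq m ζ b hw0n hpole, hx0, hfix0]
  have hT : ∀ (w : ℂ), w ≠ 0 → ∀ j,
      Tj z b j w = w ^ (n - 1) * ∏ k ∈ Finset.univ.erase j, (b + 1 / w - z k) := by
    intro w hw j
    rw [Tj, Finset.prod_congr rfl fun k _ => Lk_eq z b hw k, Finset.prod_mul_distrib]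
    simp
  have hderw : ‖deriv (fun x => Dw z b x / Ew z m ζ b x) w0‖ ≤ 1 := by
    rw [deriv_w z m ζ b w0 hEn]
    have hsum : - (∑ j, (m j : ℂ) * Tj z b j w0 ^ 2) = Dw z b w0 ^ 2 * dr z m z0 / w0 ^ 2 := by
      rw [dr, mul_neg, neg_div, Finset.mul_sum, Finset.sum_div]
      congr 1
      refine Finset.sum_congr rfl fun j _ => ?_
      have hDj : Dw z b w0 = Lk z b w0 j * Tj z b j w0 :=
        (Finset.mul_prod_erase Finset.univ _ (Finset.mem_univ j)).symm
      rw [hDj, Lk_eq z b hw0n, hx0]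
      have := sub_ne_zero.2 (h0 j)
      field_simp
    have : - (∑ j, (m j : ℂ) * Tj z b j w0 ^ 2) / Ew z m ζ b w0 ^ 2
        = dr z m z0 * ((z0 - b) / conj (z0 - b)) ^ 2 := by
      rw [hsum, hE1]
      have hDn' := hDn
      generalize Dw z b w0 = d at hDn' ⊢
      rw [hw0]
      field_simp
    rw [this, norm_mul, norm_pow, norm_div, Complex.norm_conj,
      div_self (norm_ne_zero_iff.2 hz0b)]
    simpa using hdr0
  have hcontw : ContinuousAt (GG (Dw z b) (Ew z m ζ b)) w0 :=
    GG_continuousAt (Dw_diff z b) (Ew_diff z m ζ b) hEn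
  have htw : Tendsto (GG (Dw z b) (Ew z m ζ b)) (𝓝 w0) (𝓝 w0) := by
    simpa [ContinuousAt, hfixw] using hcontw
  have hEev : ∀ᶠ w in 𝓝 w0, Ew z m ζ b w ≠ 0 :=
    (Ew_diff z m ζ b).continuous.continuousAt.eventually_ne hEn
  have hnew : ¬ ∀ᶠ w in 𝓝 w0, GG (Dw z b) (Ew z m ζ b) (GG (Dw z b) (Ew z m ζ b) w) = w := by
    intro hid
    apply nonid hn hz hm ζ z0 h0 hfix0
    have htx : Tendsto (fun x => 1 / (x - b)) (𝓝 z0) (𝓝 w0) :=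
      tendsto_const_nhds.div (tendsto_id.sub_const b) hz0b
    have hev := htx.eventually (hid.and (hEev.and (htw.eventually hEev)))
    have hcx : ContinuousAt (GG (P1 z m ζ) (D0 z)) z0 :=
      GG_continuousAt (P1_diff z m ζ) (D0_diff z) (D0_ne.2 h0)
    have hfx : GG (P1 z m ζ) (D0 z) z0 = z0 := by rw [GG1_eq m ζ h0, hfix0]
    have htt : Tendsto (GG (P1 z m ζ) (D0 z)) (𝓝 z0) (𝓝 z0) := by
      simpa [ContinuousAt, hfx] using hcx
    filter_upwards [hev, eventually_nonpole z h0, htt.eventually (eventually_nonpole z h0),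
      eventually_ne_nhds (sub_ne_zero.1 hz0b)] with x ⟨hx1, hx2, hx3⟩ hx4 hx5 hx6
    have hxb : x - b ≠ 0 := sub_ne_zero.2 hx6
    have e1 := semiconj z m ζ b _ hx2
    have e2 := semiconj z m ζ b _ hx3
    rw [hx1, ← e1, iw_of_ne b (one_div_ne_zero hxb)] at e2
    simp only [one_div_one_div, add_sub_cancel] at e2
    rw [GG1_eq m ζ hx4] at hx5
    rw [Fh_coe m ζ hx4, Fh_coe m ζ hx5] at e2
    rw [GG1_eq m ζ hx4, GG1_eq m ζ hx5]
    exact OnePoint.coe_injective e2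
  obtain ⟨δ, hδ, hball⟩ := Metric.isOpen_iff.1 hVo b hb
  obtain ⟨c, hc1, hc2, hc3⟩ := fatou (Dw z b) (Ew z m ζ b) (Dw_diff z b) (Ew_diff z m ζ b)
    (fun w hw => Ew_Dw_cz hz hm ζ b w hw) w0 hEn hfixw hderw hnew (1 / δ) (by
      intro w hw1 hw2
      by_contra hcon
      push Not at hcon
      have hwpos : 0 < ‖w‖ := lt_trans (by positivity) hcon
      have hwn : w ≠ 0 := norm_pos_iff.1 hwpos
      have hin : b + 1 / w ∈ V := by
        apply hball
        rw [mem_ball, dist_eq_norm, add_sub_cancel_left, norm_div, norm_one]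
        rw [div_lt_comm₀ hwpos hδ]; exact hcon
      have t1 := hV _ hin
      have t2 := iw_tendsto b hw0n hw2
      simp_rw [← semiconj_iter z m ζ b w hw1, iw_of_ne b hwn, hx0] at t2
      exact h01 (OnePoint.coe_injective (tendsto_nhds_unique t2 t1)))
  have hEc := hc2 0
  simp only [Function.iterate_zero, id] at hEc
  rw [deriv_w z m ζ b c hEc, div_eq_zero_iff, neg_eq_zero] at hc1
  have hNc : ∑ j, (m j : ℂ) * Tj z b j c ^ 2 = 0 := hc1.resolve_right (pow_ne_zero _ hEc)
  have hcn : c ≠ 0 := by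
    rintro rfl
    have : ∑ j, (m j : ℂ) * Tj z b j 0 ^ 2 = ((∑ j, m j : ℝ) : ℂ) := by
      push_cast
      refine Finset.sum_congr rfl fun j _ => ?_
      simp [Tj, Lk]
    rw [this, Complex.ofReal_eq_zero] at hNc
    have : 0 < ∑ j, m j := Finset.sum_pos (fun j _ => hm j) ⟨⟨0, by omega⟩, Finset.mem_univ _⟩
    linarith
  refine ⟨b + 1 / c, ?_, ?_⟩
  · have : ∑ j, (m j : ℂ) * Tj z b j c ^ 2 = (c ^ (n - 1)) ^ 2 * NN z m (b + 1 / c) := by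
      rw [NN, Finset.mul_sum]
      refine Finset.sum_congr rfl fun j _ => ?_
      rw [hT c hcn]; ring
    rw [this] at hNc
    exact (mul_eq_zero.1 hNc).resolve_left (pow_ne_zero _ (pow_ne_zero _ hcn))
  · have t2 := iw_tendsto b hw0n hc3
    simp_rw [← semiconj_iter z m ζ b c hc2, iw_of_ne b hcn, hx0] at t2
    exact t2

theorem pos_count {n : ℕ} (hn : 2 ≤ n) {z : Fin n → ℂ} (hz : Function.Injective z) {m : Fin n → ℝ}
    (hm : ∀ j, 0 < m j) (ζ : ℂ) (S : Finset ℂ)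
    (hS : ∀ x ∈ S, (∀ j, x ≠ z j) ∧ ζ + conj (r0 z m x) = x ∧ ‖dr z m x‖ ≤ 1) :
    S.card ≤ 2 * n - 2 := by
  by_cases h1 : S.card ≤ 1
  · omega
  push Not at h1
  open Polynomial in
  let N : ℂ[X] := ∑ j, C (m j : ℂ) * (∏ k ∈ Finset.univ.erase j, (X - C (z k))) ^ 2
  have hNe : ∀ x, N.eval x = NN z m x := by
    intro x
    simp [N, NN, Polynomial.eval_finsetSum, Polynomial.eval_prod]
  have hdeg : N.natDegree ≤ 2 * n - 2 := by
    apply Polynomial.natDegree_sum_le_of_forall_le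
    intro j _
    refine (Polynomial.natDegree_C_mul_le _ _).trans (Polynomial.natDegree_pow_le.trans ?_)
    have : (∏ k ∈ Finset.univ.erase j, (Polynomial.X - Polynomial.C (z k))).natDegree ≤ n - 1 := by
      refine (Polynomial.natDegree_prod_le _ _).trans ?_
      simp
    omega
  have hN0 : N ≠ 0 := by
    intro h
    let i : Fin n := ⟨0, by omega⟩
    have h2 := hNe (z i)
    rw [h, Polynomial.eval_zero] at h2
    have h3 : NN z m (z i) = (m i : ℂ) * (∏ k ∈ Finset.univ.erase i, (z i - z k)) ^ 2 := by
      apply Finset.sum_eq_single i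
      · intro j _ hj
        rw [Finset.prod_eq_zero (i := i) (by simp [hj.symm]) (by simp)]; simp
      · simp
    rw [h3] at h2
    refine mul_ne_zero (by exact_mod_cast (hm i).ne') (pow_ne_zero 2
      (Finset.prod_ne_zero_iff.2 fun k hk => ?_)) h2.symm
    rw [sub_ne_zero]
    intro h
    exact (Finset.ne_of_mem_erase hk) (hz h).symm
  have hex : ∀ x ∈ S, ∃ c : ℂ, NN z m c = 0 ∧
      Tendsto (fun k => (Fh z m ζ)^[k] (c : OnePoint ℂ)) atTop (𝓝 (x : OnePoint ℂ)) := by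
    intro x hx
    obtain ⟨y, hy, hyx⟩ := Finset.exists_mem_ne h1 x
    obtain ⟨a1, a2, a3⟩ := hS x hx
    obtain ⟨b1, b2, b3⟩ := hS y hy
    exact crit_exists hn hz hm ζ x y hyx.symm a1 a2 a3 b1 b2 b3
  choose! c hc1 hc2 using hex
  have hinj : Set.InjOn c S := by
    intro x hx y hy hxy
    have t1 := hc2 x hx
    have t2 := hc2 y hy
    rw [← hxy] at t2
    exact OnePoint.coe_injective (tendsto_nhds_unique t1 t2)
  calc S.card ≤ N.roots.toFinset.card := by
        apply Finset.card_le_card_of_injOn c _ hinj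
        intro x hx
        simp only [Finset.mem_coe, Multiset.mem_toFinset, Polynomial.mem_roots hN0,
          Polynomial.IsRoot.def, hNe]
        exact hc1 x hx
    _ ≤ N.roots.card := Multiset.toFinset_card_le _
    _ ≤ N.natDegree := Polynomial.card_roots' N
    _ ≤ _ := hdeg

end KN


namespace KN
open Set Filter Topology Metric ComplexConjugate MeasureTheory

noncomputable def et {n : ℕ} (z : Fin n → ℂ) (m : Fin n → ℝ) (x : ℂ) : ℂ := x - conj (r0 z m x)

noncomputable def JJ {n : ℕ} (z : Fin n → ℂ) (m : Fin n → ℝ) (x : ℂ) : ℝ := 1 - ‖dr z m x‖ ^ 2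

def Om {n : ℕ} (z : Fin n → ℂ) : Set ℂ := {x | ∀ j, x ≠ z j}

noncomputable def dA (a : ℂ) : ℂ →L[ℝ] ℂ :=
  ContinuousLinearMap.id ℝ ℂ -
    (Complex.conjCLE : ℂ →L[ℝ] ℂ).comp ((ContinuousLinearMap.mul ℝ ℂ) a)

lemma dA_apply (a u : ℂ) : dA a u = u - conj (a * u) := by
  simp [dA]

lemma dA_det (a : ℂ) : (dA a).det = 1 - ‖a‖ ^ 2 := by
  have : (dA a).det = LinearMap.det ((dA a : ℂ →L[ℝ] ℂ) : ℂ →ₗ[ℝ] ℂ) := rfl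
  rw [this, ← LinearMap.det_toMatrix Complex.basisOneI, Matrix.det_fin_two]
  simp only [LinearMap.toMatrix_apply, Complex.coe_basisOneI_repr, Complex.coe_basisOneI,
    ContinuousLinearMap.coe_coe, dA_apply]
  rw [← Complex.normSq_eq_norm_sq, Complex.normSq_apply]
  simp
  ring

lemma isOpen_Om {n : ℕ} (z : Fin n → ℂ) : IsOpen (Om z) := by
  rw [isOpen_iff_mem_nhds]
  intro x hx
  exact eventually_nonpole z hx

lemma r0_contDiffAt {n : ℕ} (z : Fin n → ℂ) (m : Fin n → ℝ) {x : ℂ} (hx : x ∈ Om z) :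
    ContDiffAt ℝ 1 (r0 z m) x := by
  unfold r0
  refine ContDiffAt.sum fun j _ => ?_
  have h : ContDiffAt ℂ 1 (fun x => (m j : ℂ) / (x - z j)) x :=
    ContDiffAt.fun_div contDiffAt_const (contDiffAt_id.sub contDiffAt_const) (sub_ne_zero.2 (hx j))
  exact h.restrict_scalars ℝ

lemma dr_contDiffAt {n : ℕ} (z : Fin n → ℂ) (m : Fin n → ℝ) {x : ℂ} (hx : x ∈ Om z) :
    ContDiffAt ℝ 1 (dr z m) x := by
  unfold dr
  refine ContDiffAt.neg (ContDiffAt.sum fun j _ => ?_)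
  have h : ContDiffAt ℂ 1 (fun x => (m j : ℂ) / (x - z j) ^ 2) x :=
    ContDiffAt.fun_div contDiffAt_const ((contDiffAt_id.sub contDiffAt_const).pow 2)
      (pow_ne_zero 2 (sub_ne_zero.2 (hx j)))
  exact h.restrict_scalars ℝ

lemma et_contDiffAt {n : ℕ} (z : Fin n → ℂ) (m : Fin n → ℝ) {x : ℂ} (hx : x ∈ Om z) :
    ContDiffAt ℝ 1 (et z m) x := by
  unfold et
  exact contDiffAt_id.sub (Complex.conjCLE.contDiff.contDiffAt.comp x (r0_contDiffAt z m hx))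

lemma et_hasFDerivAt {n : ℕ} (z : Fin n → ℂ) (m : Fin n → ℝ) {x : ℂ} (hx : x ∈ Om z) :
    HasFDerivAt (et z m) (dA (dr z m x)) x := by
  have h1 : HasFDerivAt (r0 z m) ((ContinuousLinearMap.mul ℝ ℂ) (dr z m x)) x := by
    have := (r0_hasDerivAt z m hx).hasFDerivAt.restrictScalars ℝ
    refine this.congr_fderiv ?_
    ext u; simp [mul_comm]
  exact (hasFDerivAt_id x).sub (Complex.conjCLE.hasFDerivAt.comp x h1)

lemma et_hasStrictFDerivAt {n : ℕ} (z : Fin n → ℂ) (m : Fin n → ℝ) {x : ℂ} (hx : x ∈ Om z) :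
    HasStrictFDerivAt (et z m) (dA (dr z m x)) x :=
  (et_contDiffAt z m hx).hasStrictFDerivAt' (et_hasFDerivAt z m hx) (by norm_num)

lemma JJ_continuousOn {n : ℕ} (z : Fin n → ℂ) (m : Fin n → ℝ) : ContinuousOn (JJ z m) (Om z) := by
  intro x hx
  have := (dr_contDiffAt z m hx).continuousAt
  unfold JJ
  exact (continuousAt_const.sub (this.norm.pow 2)).continuousWithinAt

/-- local injectivity and openness -/
lemma et_local {n : ℕ} (z : Fin n → ℂ) (m : Fin n → ℝ) {x : ℂ} (hx : x ∈ Om z) (hJ : JJ z m x ≠ 0)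
    {O : Set ℂ} (hO : O ∈ 𝓝 x) :
    ∃ W ⊆ O, IsOpen W ∧ x ∈ W ∧ InjOn (et z m) W ∧ et z m '' W ∈ 𝓝 (et z m x) := by
  have hdet : (dA (dr z m x)).det ≠ 0 := by rw [dA_det]; exact hJ
  have hs := et_hasStrictFDerivAt z m hx
  let e : ℂ ≃L[ℝ] ℂ := (dA (dr z m x)).toContinuousLinearEquivOfDetNeZero hdet
  have hs' : HasStrictFDerivAt (et z m) (e : ℂ →L[ℝ] ℂ) x := by
    refine hs.congr_fderiv ?_
    exact (ContinuousLinearMap.coe_toContinuousLinearEquivOfDetNeZero _ hdet).symm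
  let h := hs'.toOpenPartialHomeomorph (et z m)
  have hxs : x ∈ h.source := hs'.mem_toOpenPartialHomeomorph_source
  refine ⟨interior O ∩ h.source, fun y hy => interior_subset hy.1, isOpen_interior.inter h.open_source,
    ⟨mem_interior_iff_mem_nhds.2 hO, hxs⟩, ?_, ?_⟩
  · intro a ha b hb hab
    exact h.injOn ha.2 hb.2 hab
  · rw [← hs'.map_nhds_eq_of_equiv]
    apply image_mem_map
    exact (isOpen_interior.inter h.open_source).mem_nhds ⟨mem_interior_iff_mem_nhds.2 hO, hxs⟩

lemma area_inj {n : ℕ} (z : Fin n → ℂ) (m : Fin n → ℝ) {W : Set ℂ} (hW : MeasurableSet W)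
    (hWO : W ⊆ Om z) (hinj : InjOn (et z m) W) (g : ℂ → ENNReal) :
    ∫⁻ x in W, ENNReal.ofReal |JJ z m x| * g (et z m x) = ∫⁻ y in et z m '' W, g y := by
  rw [lintegral_image_eq_lintegral_abs_det_fderiv_mul volume hW
    (fun x hx => (et_hasFDerivAt z m (hWO hx)).hasFDerivWithinAt) hinj]
  simp only [dA_det, JJ]

lemma image_meas {n : ℕ} (z : Fin n → ℂ) (m : Fin n → ℝ) {W : Set ℂ} (hW : MeasurableSet W)
    (hWO : W ⊆ Om z) (hinj : InjOn (et z m) W) : MeasurableSet (et z m '' W) :=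
  measurable_image_of_fderivWithin hW
    (fun x hx => (et_hasFDerivAt z m (hWO hx)).hasFDerivWithinAt) hinj

lemma area_upper {n : ℕ} (z : Fin n → ℂ) (m : Fin n → ℝ) {O : Set ℂ} (hO : IsOpen O)
    (hOO : O ⊆ Om z) (hJ : ∀ x ∈ O, JJ z m x ≠ 0) (g : ℂ → ENNReal) (hg : Measurable g) (k : ℕ)
    (hk : ∀ y, g y ≠ 0 → ∀ S : Finset ℂ, (∀ x ∈ S, x ∈ O ∧ et z m x = y) → S.card ≤ k) :
    ∫⁻ x in O, ENNReal.ofReal |JJ z m x| * g (et z m x) ≤ k * ∫⁻ y, g y := by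
  have hloc : ∀ x ∈ O, ∃ W ⊆ O, IsOpen W ∧ x ∈ W ∧ InjOn (et z m) W := fun x hx => by
    obtain ⟨W, h1, h2, h3, h4, -⟩ := et_local z m (hOO hx) (hJ x hx) (hO.mem_nhds hx)
    exact ⟨W, h1, h2, h3, h4⟩
  rcases O.eq_empty_or_nonempty with rfl | ⟨x0, hx0⟩
  · simp
  choose! W hW1 hW2 hW3 hW4 using hloc
  obtain ⟨t, htO, htc, htcov⟩ := TopologicalSpace.countable_cover_nhdsWithin (f := W) (s := O)
    (fun x hx => mem_nhdsWithin_of_mem_nhds ((hW2 x hx).mem_nhds (hW3 x hx)))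
  have htn : t.Nonempty := by
    by_contra h
    rw [Set.not_nonempty_iff_eq_empty] at h
    have := htcov hx0
    simp [h] at this
  obtain ⟨s, hs⟩ := htc.exists_eq_range htn
  have hsO : ∀ i, s i ∈ O := fun i => htO (by rw [hs]; exact mem_range_self i)
  let V : ℕ → Set ℂ := fun i => W (s i)
  let D : ℕ → Set ℂ := disjointed V
  have hDV : ∀ i, D i ⊆ V i := fun i => disjointed_subset V i
  have hDm : ∀ i, MeasurableSet (D i) := fun i =>
    MeasurableSet.disjointed (fun i => (hW2 _ (hsO i)).measurableSet) i
  have hDU : ⋃ i, D i = O := by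
    rw [iUnion_disjointed]
    apply Subset.antisymm
    · exact iUnion_subset fun i => hW1 _ (hsO i)
    · intro x hx
      have := htcov hx
      rw [hs] at this
      simpa using this
  have hDO : ∀ i, D i ⊆ O := fun i => (hDV i).trans (hW1 _ (hsO i))
  have hDd : Pairwise (Function.onFun Disjoint D) := disjoint_disjointed V
  have hDi : ∀ i, InjOn (et z m) (D i) := fun i => (hW4 _ (hsO i)).mono (hDV i)
  have him : ∀ i, MeasurableSet (et z m '' D i) := fun i =>
    image_meas z m (hDm i) ((hDO i).trans hOO) (hDi i)
  conv_lhs => rw [← hDU, lintegral_iUnion hDm hDd]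
  simp_rw [fun i => area_inj z m (hDm i) ((hDO i).trans hOO) (hDi i) g]
  simp_rw [fun i => (lintegral_indicator (μ := volume) (him i) g).symm]
  rw [← lintegral_tsum (fun i => (hg.indicator (him i)).aemeasurable)]
  rw [← lintegral_const_mul _ hg]
  refine lintegral_mono fun y => ?_
  by_cases hy : g y = 0
  · have : ∀ i, (et z m '' D i).indicator g y = 0 := by
      intro i; by_cases h : y ∈ et z m '' D i <;> simp [h, hy]
    simp [this]
  · refine ENNReal.summable.tsum_le_of_sum_le fun F => ?_
    classical
    let F' := F.filter (fun i => y ∈ et z m '' D i)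
    have e1 : ∑ i ∈ F, (et z m '' D i).indicator g y = F'.card * g y := by
      rw [Finset.card_eq_sum_ones, Nat.cast_sum, Finset.sum_mul, Finset.sum_filter]
      refine Finset.sum_congr rfl fun i _ => ?_
      by_cases h : y ∈ et z m '' D i <;> simp [h]
    rw [e1]
    gcongr
    have hex : ∀ i ∈ F', ∃ x, x ∈ D i ∧ et z m x = y := fun i hi => (Finset.mem_filter.1 hi).2
    choose! p hp1 hp2 using hex
    have hpinj : Set.InjOn p F' := by
      intro i hi j hj hij
      by_contra hne
      exact Set.disjoint_left.1 (hDd hne) (hp1 i hi) (hij ▸ hp1 j hj)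
    rw [← Finset.card_image_of_injOn hpinj]
    apply hk y hy
    intro x hx
    obtain ⟨i, hi, rfl⟩ := Finset.mem_image.1 hx
    exact ⟨hDO i (hp1 i hi), hp2 i hi⟩

lemma area_lower {n : ℕ} (z : Fin n → ℂ) (m : Fin n → ℝ) {O : Set ℂ} (hO : IsOpen O)
    (hOO : O ⊆ Om z) (hJ : ∀ x ∈ O, JJ z m x ≠ 0) (ζ : ℂ) (S : Finset ℂ)
    (hS : ∀ x ∈ S, x ∈ O ∧ et z m x = ζ) :
    ∃ ε > 0, ∀ g : ℂ → ENNReal, (∀ y, y ∉ ball ζ ε → g y = 0) →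
      S.card * ∫⁻ y, g y ≤ ∫⁻ x in O, ENNReal.ofReal |JJ z m x| * g (et z m x) := by
  obtain ⟨U, hU, hUd⟩ := S.finite_toSet.t2_separation
  have hex : ∀ x ∈ S, ∃ W ⊆ O ∩ U x, IsOpen W ∧ x ∈ W ∧ InjOn (et z m) W ∧ et z m '' W ∈ 𝓝 ζ := by
    intro x hx
    have := et_local z m (hOO (hS x hx).1) (hJ x (hS x hx).1)
      ((hO.inter (hU x).2).mem_nhds ⟨(hS x hx).1, (hU x).1⟩)
    rwa [(hS x hx).2] at this
  choose! W hW1 hW2 hW3 hW4 hW5 using hex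
  have hall : (⋂ x ∈ S, et z m '' W x) ∈ 𝓝 ζ := (Filter.biInter_finset_mem S).2 hW5
  obtain ⟨ε, hε, hball⟩ := Metric.mem_nhds_iff.1 hall
  refine ⟨ε, hε, fun g hg => ?_⟩
  have hWd : Set.PairwiseDisjoint (S : Set ℂ) W := by
    intro a ha b hb hab
    exact (hUd ha hb hab).mono (fun y hy => (hW1 a ha hy).2) (fun y hy => (hW1 b hb hy).2)
  calc (S.card : ENNReal) * ∫⁻ y, g y
      = ∑ x ∈ S, ∫⁻ y in et z m '' W x, g y := by
        rw [Finset.card_eq_sum_ones, Nat.cast_sum, Finset.sum_mul]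
        refine Finset.sum_congr rfl fun x hx => ?_
        have hm := image_meas z m (hW2 x hx).measurableSet
          (fun y hy => hOO (hW1 x hx hy).1) (hW4 x hx)
        rw [← lintegral_indicator hm]
        simp only [Nat.cast_one, one_mul]
        refine lintegral_congr fun y => ?_
        by_cases hy : y ∈ et z m '' W x
        · simp only [Set.indicator_of_mem hy]
        · rw [Set.indicator_of_notMem hy]
          apply hg
          intro hyb
          exact hy (mem_iInter₂.1 (hball hyb) x hx)
    _ = ∑ x ∈ S, ∫⁻ y in W x, ENNReal.ofReal |JJ z m y| * g (et z m y) := by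
        refine Finset.sum_congr rfl fun x hx => ?_
        rw [area_inj z m (hW2 x hx).measurableSet (fun y hy => hOO (hW1 x hx hy).1) (hW4 x hx)]
    _ = ∫⁻ y in ⋃ x ∈ S, W x, ENNReal.ofReal |JJ z m y| * g (et z m y) := by
        rw [lintegral_biUnion_finset hWd (fun x hx => (hW2 x hx).measurableSet)]
    _ ≤ _ := by
        apply lintegral_mono_set
        exact iUnion₂_subset fun x hx y hy => (hW1 x hx hy).1

end KN


namespace KN
open Set Filter Topology Metric ComplexConjugate MeasureTheory

lemma r0_bound {n : ℕ} (z : Fin n → ℂ) {m : Fin n → ℝ} (hm : ∀ j, 0 < m j) {x : ℂ} {δ : ℝ}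
    (hδ : 0 < δ) (hx : ∀ j, δ ≤ ‖x - z j‖) : ‖r0 z m x‖ ≤ (∑ j, m j) / δ := by
  rw [r0, Finset.sum_div]
  refine norm_sum_le_of_le _ fun j _ => ?_
  rw [norm_div, Complex.norm_real, Real.norm_of_nonneg (hm j).le]
  exact div_le_div_of_nonneg_left (hm j).le hδ (hx j)

lemma exists_compact {n : ℕ} {z : Fin n → ℂ} (hz : Function.Injective z) {m : Fin n → ℝ}
    (hm : ∀ j, 0 < m j) (R : ℝ) :
    ∃ K : Set ℂ, IsCompact K ∧ K ⊆ Om z ∧ ∀ x ∈ Om z, ‖et z m x‖ ≤ R → x ∈ K := by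
  let K : Set ℂ := {x | ‖conj x * D0 z x - PP z m x‖ ≤ R * ‖D0 z x‖}
  have hmem : ∀ x ∈ Om z, (x ∈ K ↔ ‖et z m x‖ ≤ R) := by
    intro x hx
    have hD : D0 z x ≠ 0 := D0_ne.2 hx
    have h1 : conj x * D0 z x - PP z m x = D0 z x * conj (et z m x) := by
      rw [PP_eq m hx, et]; simp only [map_sub, Complex.conj_conj]; ring
    change ‖conj x * D0 z x - PP z m x‖ ≤ R * ‖D0 z x‖ ↔ _
    rw [h1, norm_mul, Complex.norm_conj, mul_comm R]
    exact mul_le_mul_iff_right₀ (norm_pos_iff.2 hD)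
  have hKO : K ⊆ Om z := by
    intro x hx j hj
    subst hj
    have hD : D0 z (z j) = 0 := Finset.prod_eq_zero (Finset.mem_univ j) (by simp)
    change ‖conj (z j) * D0 z (z j) - PP z m (z j)‖ ≤ R * ‖D0 z (z j)‖ at hx
    simp only [hD, mul_zero, zero_sub, norm_neg, norm_zero] at hx
    exact PP_pole hz hm j (norm_le_zero_iff.1 hx)
  refine ⟨K, ?_, hKO, fun x hx h => (hmem x hx).2 h⟩
  refine Metric.isCompact_of_isClosed_isBounded ?_ ?_
  · have h1 := (D0_diff z).continuous
    have h2 := (PP_diff z m).continuous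
    have h3 := Complex.continuous_conj
    exact isClosed_le ((h3.mul h1).sub h2).norm (continuous_const.mul h1.norm)
  · have hM : 0 ≤ ∑ j, m j := Finset.sum_nonneg fun j _ => (hm j).le
    refine (Metric.isBounded_closedBall (x := (0:ℂ))
      (r := |R| + ∑ j, m j + ∑ j, ‖z j‖ + 1)).subset ?_
    intro x hx
    rw [mem_closedBall_zero_iff]
    have hzn : ∀ j, ‖z j‖ ≤ ∑ j, ‖z j‖ := fun j =>
      Finset.single_le_sum (f := fun j => ‖z j‖) (fun j _ => norm_nonneg _) (Finset.mem_univ j)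
    have hzs : 0 ≤ ∑ j, ‖z j‖ := Finset.sum_nonneg fun j _ => norm_nonneg _
    by_cases h : ∀ j, 1 ≤ ‖x - z j‖
    · have h1 := r0_bound z hm one_pos h
      have h2 := (hmem x (hKO hx)).1 hx
      have h3 : ‖x‖ ≤ ‖et z m x‖ + ‖r0 z m x‖ := by
        have : x = et z m x + conj (r0 z m x) := by simp [et]
        calc ‖x‖ = ‖et z m x + conj (r0 z m x)‖ := by rw [← this]
          _ ≤ _ := by
            refine (norm_add_le _ _).trans ?_
            rw [Complex.norm_conj]
      rw [div_one] at h1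
      linarith [le_abs_self R]
    · push Not at h
      obtain ⟨j, hj⟩ := h
      have : ‖x‖ ≤ ‖x - z j‖ + ‖z j‖ := by
        simpa using norm_add_le (x - z j) (z j)
      linarith [hzn j, abs_nonneg R]

lemma ext_contDiff {O K : Set ℂ} (hO : IsOpen O) (hK : IsCompact K) (hKO : K ⊆ O) {q : ℂ → ℝ}
    (hq : ∀ x ∈ O, ContDiffAt ℝ 1 q x) (h0 : ∀ x ∈ O, x ∉ K → q x = 0) :
    ContDiff ℝ 1 (O.indicator q) ∧ HasCompactSupport (O.indicator q) := by
  have hz : ∀ x, x ∉ K → O.indicator q x = 0 := by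
    intro x hx
    by_cases h : x ∈ O
    · rw [indicator_of_mem h, h0 x h hx]
    · rw [indicator_of_notMem h]
  refine ⟨?_, HasCompactSupport.intro hK hz⟩
  rw [contDiff_iff_contDiffAt]
  intro x
  by_cases h : x ∈ O
  · refine (hq x h).congr_of_eventuallyEq ?_
    filter_upwards [hO.mem_nhds h] with y hy using indicator_of_mem hy _
  · refine (contDiffAt_const (c := (0:ℝ))).congr_of_eventuallyEq ?_
    filter_upwards [hK.isClosed.isOpen_compl.mem_nhds (fun hx => h (hKO hx))] with y hy using hz y hy

lemma int_dir_zero {k : ℂ → ℝ} (hk : ContDiff ℝ 1 k) (hc : HasCompactSupport k) (v : ℂ) :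
    Integrable (fun x => fderiv ℝ k x v) ∧ ∫ x, fderiv ℝ k x v = 0 := by
  have hcf : Continuous (fun x => fderiv ℝ k x v) :=
    (hk.continuous_fderiv (by norm_num)).clm_apply continuous_const
  have hcs : HasCompactSupport (fun x => fderiv ℝ k x v) := hc.fderiv_apply ℝ v
  have hi : Integrable (fun x => fderiv ℝ k x v) := hcf.integrable_of_hasCompactSupport hcs
  have hik : Integrable k := hk.continuous.integrable_of_hasCompactSupport hc
  refine ⟨hi, ?_⟩
  have := integral_bilinear_hasLineDerivAt_right_eq_neg_left_of_integrable (μ := (volume : Measure ℂ))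
    (f := fun _ => (1:ℝ)) (f' := fun _ => (0:ℝ)) (g := k) (g' := fun x => fderiv ℝ k x v) (v := v)
    (B := ContinuousLinearMap.mul ℝ ℝ) (by simp) (by simpa using hi) (by simpa using hik)
    (by
      intro x _
      exact (hasFDerivAt_const (1:ℝ) x).hasLineDerivAt v)
    (by
      intro x _
      exact ((hk.differentiable (by norm_num)) x).hasFDerivAt.hasLineDerivAt v)
  simpa using this

lemma Om_restrict {n : ℕ} (z : Fin n → ℂ) : (volume : Measure ℂ).restrict (Om z) = volume := by
  apply Measure.restrict_eq_self_of_ae_mem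
  have : (Om z)ᶜ = ⋃ j, {z j} := by
    ext x; simp [Om, eq_comm]
  rw [ae_iff]
  change volume ((Om z)ᶜ) = 0
  rw [this]
  exact (Set.finite_iUnion fun j => Set.finite_singleton (z j)).measure_zero _

lemma dr_differentiableAt {n : ℕ} (z : Fin n → ℂ) (m : Fin n → ℝ) {x : ℂ} (hx : x ∈ Om z) :
    DifferentiableAt ℂ (dr z m) x := by
  unfold dr
  refine DifferentiableAt.neg (DifferentiableAt.fun_sum fun j _ => ?_)
  have := pow_ne_zero 2 (sub_ne_zero.2 (hx j))
  fun_prop (disch := assumption)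

lemma stokes {n : ℕ} {z : Fin n → ℂ} (hz : Function.Injective z) {m : Fin n → ℝ}
    (hm : ∀ j, 0 < m j) {H : ℂ → ℝ} (hH : ContDiff ℝ 1 H) (R : ℝ) (hR : ∀ y, R < ‖y‖ → H y = 0)
    (v : ℂ) : ∫ x in Om z, fderiv ℝ H (et z m x) v * JJ z m x = 0 := by
  obtain ⟨K, hK, hKO, hKm⟩ := exists_compact hz hm R
  have hO := isOpen_Om z
  have hH0 : ∀ x ∈ Om z, x ∉ K → H (et z m x) = 0 := by
    intro x hx hxK
    apply hR
    by_contra h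
    exact hxK (hKm x hx (not_lt.1 h))
  have hHe : ∀ x ∈ Om z, ContDiffAt ℝ 1 (fun x => H (et z m x)) x := fun x hx =>
    hH.contDiffAt.comp x (et_contDiffAt z m hx)
  have hdv : ∀ x ∈ Om z, ContDiffAt ℝ 1 (fun x => dr z m x * v) x := fun x hx =>
    (dr_contDiffAt z m hx).mul contDiffAt_const
  have hre : ∀ x ∈ Om z, ContDiffAt ℝ 1 (fun x => (dr z m x * v).re) x := fun x hx =>
    Complex.reCLM.contDiff.contDiffAt.comp x (hdv x hx)
  have him : ∀ x ∈ Om z, ContDiffAt ℝ 1 (fun x => (dr z m x * v).im) x := fun x hx =>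
    Complex.imCLM.contDiff.contDiffAt.comp x (hdv x hx)
  obtain ⟨a1, b1⟩ := ext_contDiff hO hK hKO hHe hH0
  obtain ⟨a2, b2⟩ := ext_contDiff hO hK hKO
    (q := fun x => (dr z m x * v).re * H (et z m x)) (fun x hx => (hre x hx).mul (hHe x hx))
    (fun x hx h => by simp [hH0 x hx h])
  obtain ⟨a3, b3⟩ := ext_contDiff hO hK hKO
    (q := fun x => (dr z m x * v).im * H (et z m x)) (fun x hx => (him x hx).mul (hHe x hx))
    (fun x hx h => by simp [hH0 x hx h])
  obtain ⟨i1, e1⟩ := int_dir_zero a1 b1 v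
  obtain ⟨i2, e2⟩ := int_dir_zero a2 b2 1
  obtain ⟨i3, e3⟩ := int_dir_zero a3 b3 Complex.I
  have hpt : ∀ x ∈ Om z, fderiv ℝ H (et z m x) v * JJ z m x =
      fderiv ℝ ((Om z).indicator fun x => H (et z m x)) x v
      + fderiv ℝ ((Om z).indicator fun x => (dr z m x * v).re * H (et z m x)) x 1
      - fderiv ℝ ((Om z).indicator fun x => (dr z m x * v).im * H (et z m x)) x Complex.I := by
    intro x hx
    have hev : ∀ q : ℂ → ℝ, fderiv ℝ ((Om z).indicator q) x = fderiv ℝ q x := by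
      intro q
      apply Filter.EventuallyEq.fderiv_eq
      filter_upwards [hO.mem_nhds hx] with y hy using indicator_of_mem hy _
    rw [hev, hev, hev]
    have hHd : HasFDerivAt (fun x => H (et z m x))
        ((fderiv ℝ H (et z m x)).comp (dA (dr z m x))) x :=
      ((hH.differentiable (by norm_num)) _).hasFDerivAt.comp x (et_hasFDerivAt z m hx)
    obtain ⟨s, hs⟩ : ∃ s, HasDerivAt (dr z m) s x := ⟨_, (dr_differentiableAt z m hx).hasDerivAt⟩
    have hsv : HasFDerivAt (fun x => dr z m x * v)
        ((ContinuousLinearMap.mul ℝ ℂ) (s * v)) x := by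
      refine ((hs.mul_const v).hasFDerivAt.restrictScalars ℝ).congr_fderiv ?_
      ext u; simp [mul_comm]
    have hred : HasFDerivAt (fun x => (dr z m x * v).re)
        (Complex.reCLM.comp ((ContinuousLinearMap.mul ℝ ℂ) (s * v))) x :=
      Complex.reCLM.hasFDerivAt.comp x hsv
    have himd : HasFDerivAt (fun x => (dr z m x * v).im)
        (Complex.imCLM.comp ((ContinuousLinearMap.mul ℝ ℂ) (s * v))) x :=
      Complex.imCLM.hasFDerivAt.comp x hsv
    rw [hHd.fderiv, (hred.fun_mul hHd).fderiv, (himd.fun_mul hHd).fderiv]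
    generalize fderiv ℝ H (et z m x) = L
    simp only [_root_.add_apply, _root_.smul_apply,
      ContinuousLinearMap.comp_apply, dA_apply, ContinuousLinearMap.mul_apply', smul_eq_mul,
      Complex.reCLM_apply, Complex.imCLM_apply]
    have hI : (s * v * Complex.I).im = (s * v * 1).re := by simp
    rw [hI]
    have hJ : ((JJ z m x : ℝ) : ℂ) = 1 - dr z m x * conj (dr z m x) := by
      rw [Complex.mul_conj, Complex.normSq_eq_norm_sq]; simp [JJ]
    have hLv : L v * JJ z m x = L (v * (1 - dr z m x * conj (dr z m x))) := by
      rw [← hJ, mul_comm v, ← Complex.real_smul, map_smul, smul_eq_mul, mul_comm]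
    have hvec : v * (1 - dr z m x * conj (dr z m x))
        = (v - conj (dr z m x * v)) + ((dr z m x * v).re • (1 - conj (dr z m x * 1)))
          - ((dr z m x * v).im • (Complex.I - conj (dr z m x * Complex.I))) := by
      apply Complex.ext
      · simp; ring
      · simp; ring
    rw [hLv, hvec, map_sub, map_add, map_smul, map_smul, smul_eq_mul, smul_eq_mul]
    ring
  rw [setIntegral_congr_fun hO.measurableSet hpt, Om_restrict]
  have i12 := i1.add i2
  simp only [Pi.add_def] at i12
  rw [integral_sub i12 i3, integral_add i1 i2, e1, e2, e3]
  simp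

lemma integrable_ext {n : ℕ} {z : Fin n → ℂ} {K : Set ℂ} (hK : IsCompact K) (hKO : K ⊆ Om z)
    {q : ℂ → ℝ} (hq : ContinuousOn q (Om z)) (h0 : ∀ x ∈ Om z, x ∉ K → q x = 0) :
    IntegrableOn q (Om z) :=
  ((hq.mono hKO).integrableOn_compact hK).of_forall_sdiff_eq_zero (isOpen_Om z).measurableSet
    (fun x hx => h0 x hx.1 hx.2)

lemma et_continuousOn {n : ℕ} (z : Fin n → ℂ) (m : Fin n → ℝ) : ContinuousOn (et z m) (Om z) :=
  fun _ hx => (et_contDiffAt z m hx).continuousAt.continuousWithinAt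

lemma phiJ_integrable {n : ℕ} {z : Fin n → ℂ} (hz : Function.Injective z) {m : Fin n → ℝ}
    (hm : ∀ j, 0 < m j) {φ : ℂ → ℝ} (hφ : Continuous φ) (hφ0 : ∀ y, 1 < ‖y‖ → φ y = 0) (ζ : ℂ) :
    IntegrableOn (fun x => φ (et z m x - ζ) * JJ z m x) (Om z) := by
  obtain ⟨K, hK, hKO, hKm⟩ := exists_compact hz hm (1 + ‖ζ‖)
  refine integrable_ext hK hKO ?_ ?_
  · exact (hφ.comp_continuousOn ((et_continuousOn z m).sub continuousOn_const)).mul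
      (JJ_continuousOn z m)
  · intro x hx hxK
    rw [hφ0, zero_mul]
    by_contra h
    apply hxK (hKm x hx _)
    have := norm_add_le (et z m x - ζ) ζ
    rw [sub_add_cancel] at this
    linarith

lemma invariance {n : ℕ} {z : Fin n → ℂ} (hz : Function.Injective z) {m : Fin n → ℝ}
    (hm : ∀ j, 0 < m j) {φ : ℂ → ℝ} (hφ : ContDiff ℝ 1 φ) (hφ0 : ∀ y, 1 < ‖y‖ → φ y = 0)
    (ζ ζ' : ℂ) :
    ∫ x in Om z, φ (et z m x - ζ) * JJ z m x = ∫ x in Om z, φ (et z m x - ζ') * JJ z m x := by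
  set v := ζ' - ζ with hv
  have hOm := (isOpen_Om z).measurableSet
  have hφc : HasCompactSupport φ :=
    HasCompactSupport.intro (isCompact_closedBall (0:ℂ) 1) (fun y hy => hφ0 y (by simpa using hy))
  have hfc : Continuous (fderiv ℝ φ) := hφ.continuous_fderiv (by norm_num)
  obtain ⟨C, hC⟩ := (hφc.fderiv ℝ).exists_bound_of_continuous hfc
  have hC0 : 0 ≤ C := (norm_nonneg _).trans (hC 0)
  have hfd0 : ∀ y, 1 < ‖y‖ → fderiv ℝ φ y = 0 := by
    intro y hy
    have : φ =ᶠ[𝓝 y] fun _ => 0 := by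
      filter_upwards [continuous_norm.continuousAt.eventually (lt_mem_nhds hy)] with u hu using hφ0 u hu
    rw [this.fderiv_eq]; simp
  let F : ℝ → ℂ → ℝ := fun t x => φ (et z m x - ζ - t • v) * JJ z m x
  let F' : ℝ → ℂ → ℝ := fun t x => -(fderiv ℝ φ (et z m x - ζ - t • v) v) * JJ z m x
  have hFc : ∀ t, ContinuousOn (F t) (Om z) := fun t =>
    (hφ.continuous.comp_continuousOn (((et_continuousOn z m).sub continuousOn_const).sub
      continuousOn_const)).mul (JJ_continuousOn z m)
  have hF'c : ∀ t, ContinuousOn (F' t) (Om z) := fun t => by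
    have h1 : Continuous fun y => -(fderiv ℝ φ y v) := (hfc.clm_apply continuous_const).neg
    exact (h1.comp_continuousOn (((et_continuousOn z m).sub continuousOn_const).sub
      continuousOn_const)).mul (JJ_continuousOn z m)
  have hder : ∀ t0, HasDerivAt (fun t => ∫ x in Om z, F t x) 0 t0 := by
    intro t0
    obtain ⟨K, hK, hKO, hKm⟩ := exists_compact hz hm (1 + ‖ζ‖ + (|t0| + 1) * ‖v‖)
    obtain ⟨A, hA⟩ := hK.exists_bound_of_continuousOn ((JJ_continuousOn z m).mono hKO)
    have hInt0 : IntegrableOn (F t0) (Om z) := by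
      have := phiJ_integrable hz hm hφ.continuous hφ0 (ζ + t0 • v)
      simpa only [F, sub_sub] using this
    have hzero : ∀ t ∈ ball t0 1, ∀ x ∈ Om z, x ∉ K → 1 < ‖et z m x - ζ - t • v‖ := by
      intro t ht x hx hxK
      by_contra h
      push Not at h
      apply hxK (hKm x hx _)
      have h1 : |t| ≤ |t0| + 1 := by
        rw [mem_ball, Real.dist_eq] at ht
        have := abs_sub_abs_le_abs_sub t t0
        linarith
      have h2 : ‖et z m x‖ ≤ ‖et z m x - ζ - t • v‖ + ‖ζ‖ + ‖t • v‖ := by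
        calc ‖et z m x‖ = ‖(et z m x - ζ - t • v) + ζ + t • v‖ := by congr 1; ring
          _ ≤ _ := norm_add₃_le
      rw [norm_smul, Real.norm_eq_abs] at h2
      have := mul_le_mul_of_nonneg_right h1 (norm_nonneg v)
      linarith
    have hmain := hasDerivAt_integral_of_dominated_loc_of_deriv_le (μ := volume.restrict (Om z))
      (F := F) (F' := F') (x₀ := t0) (s := ball t0 1) (bound := K.indicator fun _ => C * ‖v‖ * A)
      (ball_mem_nhds t0 one_pos)
      (Eventually.of_forall fun t => (hFc t).aestronglyMeasurable hOm) hInt0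
      ((hF'c t0).aestronglyMeasurable hOm)
      (by
        filter_upwards [ae_restrict_mem hOm] with x hx t ht
        by_cases hxK : x ∈ K
        · rw [indicator_of_mem hxK]
          simp only [F', norm_mul, norm_neg]
          refine mul_le_mul ?_ (hA x hxK) (norm_nonneg _) (by positivity)
          exact (ContinuousLinearMap.le_opNorm _ _).trans
            (mul_le_mul_of_nonneg_right (hC _) (norm_nonneg _))
        · rw [indicator_of_notMem hxK]
          simp only [F', hfd0 _ (hzero t ht x hx hxK)]
          simp)
      (by
        refine Integrable.mono_measure ?_ Measure.restrict_le_self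
        rw [integrable_indicator_iff hK.measurableSet]
        exact integrableOn_const hK.measure_lt_top.ne)
      (by
        filter_upwards [ae_restrict_mem hOm] with x hx t ht
        have h1 : HasDerivAt (fun t : ℝ => et z m x - ζ - t • v) (-v) t := by
          simpa using ((hasDerivAt_id t).smul_const v).const_sub (et z m x - ζ)
        have h2 := ((hφ.differentiable (by norm_num)) (et z m x - ζ - t • v)).hasFDerivAt.comp_hasDerivAt
          t h1
        have h3 := h2.mul_const (JJ z m x)
        simpa [F, F'] using h3)
    have hz0 : ∫ x in Om z, F' t0 x = 0 := by
      have hs := stokes hz hm (H := fun y => φ (y - ζ - t0 • v))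
        (by exact hφ.comp ((contDiff_id.sub contDiff_const).sub contDiff_const))
        (1 + ‖ζ‖ + |t0| * ‖v‖) (by
          intro y hy
          apply hφ0
          have h2 : ‖y‖ ≤ ‖y - ζ - t0 • v‖ + ‖ζ‖ + ‖t0 • v‖ := by
            calc ‖y‖ = ‖(y - ζ - t0 • v) + ζ + t0 • v‖ := by congr 1; ring
              _ ≤ _ := norm_add₃_le
          rw [norm_smul, Real.norm_eq_abs] at h2
          linarith) v
      have hfe : ∀ y, fderiv ℝ (fun y => φ (y - ζ - t0 • v)) y = fderiv ℝ φ (y - ζ - t0 • v) := by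
        intro y
        have h1 : HasFDerivAt (fun y : ℂ => y - ζ - t0 • v) (ContinuousLinearMap.id ℝ ℂ) y :=
          ((hasFDerivAt_id y).sub_const ζ).sub_const _
        have h2 := ((hφ.differentiable (by norm_num)) (y - ζ - t0 • v)).hasFDerivAt.comp y h1
        exact h2.fderiv
      simp only [hfe] at hs
      simp only [F', neg_mul, integral_neg, hs, neg_zero]
    rw [hz0] at hmain
    exact hmain.2
  have hc := is_const_of_deriv_eq_zero (fun t => (hder t).differentiableAt)
    (fun t => (hder t).deriv) 0 1
  simpa [F, hv] using hc

end KN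


namespace KN
open Set Filter Topology Metric ComplexConjugate MeasureTheory

lemma dr_bound {n : ℕ} (z : Fin n → ℂ) {m : Fin n → ℝ} (hm : ∀ j, 0 < m j) {x : ℂ} {δ : ℝ}
    (hδ : 0 < δ) (hx : ∀ j, δ ≤ ‖x - z j‖) : ‖dr z m x‖ ≤ (∑ j, m j) / δ ^ 2 := by
  rw [dr, norm_neg, Finset.sum_div]
  refine norm_sum_le_of_le _ fun j _ => ?_
  rw [norm_div, Complex.norm_real, Real.norm_of_nonneg (hm j).le, norm_pow]
  exact div_le_div_of_nonneg_left (hm j).le (by positivity) (pow_le_pow_left₀ hδ.le (hx j) 2)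

lemma r0_sub {n : ℕ} (z : Fin n → ℂ) (m : Fin n → ℝ) {x y : ℂ} (hx : x ∈ Om z) (hy : y ∈ Om z) :
    r0 z m x - r0 z m y = (y - x) * ∑ j, (m j : ℂ) / ((x - z j) * (y - z j)) := by
  rw [r0, r0, ← Finset.sum_sub_distrib, Finset.mul_sum]
  refine Finset.sum_congr rfl fun j _ => ?_
  have h1 := sub_ne_zero.2 (hx j)
  have h2 := sub_ne_zero.2 (hy j)
  field_simp
  ring

lemma far_count {n : ℕ} {z : Fin n → ℂ} (hz : Function.Injective z) {m : Fin n → ℝ}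
    (hm : ∀ j, 0 < m j) :
    ∃ R : ℝ, ∀ y : ℂ, R ≤ ‖y‖ → ∀ S : Finset ℂ,
      (∀ x ∈ S, (x ∈ Om z ∧ JJ z m x < 0) ∧ et z m x = y) → S.card ≤ n := by
  set M := ∑ j, m j with hM
  have hM0 : 0 ≤ M := Finset.sum_nonneg fun j _ => (hm j).le
  -- separation constant
  have hsep : ∃ d > 0, ∀ j k, j ≠ k → 2 * d ≤ ‖z j - z k‖ := by
    have : ∀ᶠ d : ℝ in 𝓝[>] 0, ∀ j k, j ≠ k → 2 * d ≤ ‖z j - z k‖ := by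
      rw [eventually_all]; intro j
      rw [eventually_all]; intro k
      by_cases hjk : j = k
      · simp [hjk]
      · have hpos : 0 < ‖z j - z k‖ := norm_pos_iff.2 (sub_ne_zero.2 fun h => hjk (hz h))
        have : ∀ᶠ d : ℝ in 𝓝 0, 2 * d < ‖z j - z k‖ := by
          have hc : ContinuousAt (fun d : ℝ => 2 * d) 0 := by fun_prop
          exact hc.eventually (gt_mem_nhds (by simpa using hpos))
        filter_upwards [nhdsWithin_le_nhds this] with d hd _ using hd.le
    obtain ⟨d, h1, h2⟩ := (this.and self_mem_nhdsWithin).exists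
    exact ⟨d, h2, h1⟩
  obtain ⟨d, hd, hsep⟩ := hsep
  have hdel : ∃ δ > 0, δ ≤ d ∧ ∀ j, δ ^ 2 * (1 + M / d ^ 2) < m j := by
    have : ∀ᶠ δ : ℝ in 𝓝[>] 0, δ ≤ d ∧ ∀ j, δ ^ 2 * (1 + M / d ^ 2) < m j := by
      apply nhdsWithin_le_nhds
      refine Filter.Eventually.and (ge_mem_nhds hd) ?_
      rw [eventually_all]; intro j
      have hc : ContinuousAt (fun δ : ℝ => δ ^ 2 * (1 + M / d ^ 2)) 0 := by fun_prop
      exact hc.eventually (gt_mem_nhds (by simpa using hm j))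
    obtain ⟨δ, h1, h2⟩ := (this.and self_mem_nhdsWithin).exists
    exact ⟨δ, h2, h1.1, h1.2⟩
  obtain ⟨δ, hδ, hδd, hδm⟩ := hdel
  have hZ : ∀ j, ‖z j‖ ≤ ∑ j, ‖z j‖ := fun j =>
    Finset.single_le_sum (f := fun j => ‖z j‖) (fun j _ => norm_nonneg _) (Finset.mem_univ j)
  set Z := ∑ j, ‖z j‖ with hZdef
  refine ⟨(M + 1) + Z + M / δ + 1, fun y hy S hS => ?_⟩
  have hnear : ∀ x ∈ S, ∃ j, ‖x - z j‖ < δ := by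
    intro x hx
    obtain ⟨⟨hxO, hJ⟩, hxy⟩ := hS x hx
    by_contra hcon
    push Not at hcon
    have h1 := r0_bound z hm hδ hcon
    have h2 : ∃ j, ‖x - z j‖ < M + 1 := by
      by_contra hc
      push Not at hc
      have h3 := dr_bound z hm (by linarith : (0:ℝ) < M + 1) hc
      have h4 : (∑ j, m j) / (M + 1) ^ 2 ≤ 1 := by
        rw [div_le_one (by positivity), ← hM]; nlinarith
      have h5 : ‖dr z m x‖ ^ 2 ≤ 1 := pow_le_one₀ (norm_nonneg _) (h3.trans h4)
      unfold JJ at hJ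
      linarith
    obtain ⟨j, hj⟩ := h2
    have h6 : ‖x‖ ≤ ‖x - z j‖ + ‖z j‖ := by
      simpa using norm_add_le (x - z j) (z j)
    have h7 : ‖y‖ ≤ ‖x‖ + ‖r0 z m x‖ := by
      rw [← hxy, et]
      refine (norm_sub_le _ _).trans ?_
      rw [Complex.norm_conj]
    rw [← hM] at h1
    linarith [hZ j]
  rcases S.eq_empty_or_nonempty with rfl | ⟨s0, hs0⟩
  · simp
  have hne0 : Nonempty (Fin n) := ⟨(hnear s0 hs0).choose⟩
  choose! p hp using hnear
  have hinj : Set.InjOn p S := by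
    intro x hx x' hx' hpp
    by_contra hne
    obtain ⟨⟨hxO, -⟩, hxy⟩ := hS x hx
    obtain ⟨⟨hxO', -⟩, hxy'⟩ := hS x' hx'
    set j := p x with hj
    have a1 : ‖x - z j‖ < δ := hp x hx
    have a2 : ‖x' - z j‖ < δ := by rw [hpp]; exact hp x' hx'
    have e1 : conj (r0 z m x - r0 z m x') = x - x' := by
      rw [map_sub]
      unfold et at hxy hxy'
      linear_combination hxy' - hxy
    rw [r0_sub z m hxO hxO'] at e1
    have e2 := congrArg norm e1
    rw [Complex.norm_conj, norm_mul, norm_sub_rev x' x] at e2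
    have hxx : 0 < ‖x - x'‖ := norm_pos_iff.2 (sub_ne_zero.2 hne)
    have e3 : ‖∑ k, (m k : ℂ) / ((x - z k) * (x' - z k))‖ = 1 := by
      have : ‖x - x'‖ * (‖∑ k, (m k : ℂ) / ((x - z k) * (x' - z k))‖ - 1) = 0 := by linarith
      rcases mul_eq_zero.1 this with h | h
      · exact absurd h hxx.ne'
      · linarith
    rw [← Finset.add_sum_erase _ _ (Finset.mem_univ j)] at e3
    have e4 : ‖∑ k ∈ Finset.univ.erase j, (m k : ℂ) / ((x - z k) * (x' - z k))‖ ≤ M / d ^ 2 := by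
      have h1 : ‖∑ k ∈ Finset.univ.erase j, (m k : ℂ) / ((x - z k) * (x' - z k))‖
          ≤ ∑ k ∈ Finset.univ.erase j, m k / d ^ 2 := by
        refine norm_sum_le_of_le _ fun k hk => ?_
        have hjk : j ≠ k := (Finset.ne_of_mem_erase hk).symm
        have hs := hsep j k hjk
        have hfar : ∀ u, ‖u - z j‖ < δ → d ≤ ‖u - z k‖ := by
          intro u hu
          have : ‖z j - z k‖ ≤ ‖u - z k‖ + ‖u - z j‖ := by
            have := norm_sub_le (u - z k) (u - z j)
            simpa using this
          linarith
        rw [norm_div, Complex.norm_real, Real.norm_of_nonneg (hm k).le, norm_mul]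
        refine div_le_div_of_nonneg_left (hm k).le (by positivity) ?_
        rw [pow_two]
        exact mul_le_mul (hfar x a1) (hfar x' a2) hd.le (norm_nonneg _)
      refine h1.trans ?_
      rw [← Finset.sum_div]
      gcongr
      exact Finset.sum_le_sum_of_subset_of_nonneg (Finset.erase_subset _ _)
        (fun k _ _ => (hm k).le)
    have e5 : m j / δ ^ 2 ≤ ‖(m j : ℂ) / ((x - z j) * (x' - z j))‖ := by
      rw [norm_div, Complex.norm_real, Real.norm_of_nonneg (hm j).le, norm_mul]
      have p1 : 0 < ‖x - z j‖ := norm_pos_iff.2 (sub_ne_zero.2 (hxO j))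
      have p2 : 0 < ‖x' - z j‖ := norm_pos_iff.2 (sub_ne_zero.2 (hxO' j))
      refine div_le_div_of_nonneg_left (hm j).le (by positivity) ?_
      rw [pow_two]
      exact mul_le_mul a1.le a2.le p2.le hδ.le
    have e6 : ‖(m j : ℂ) / ((x - z j) * (x' - z j))‖ ≤ 1 + M / d ^ 2 := by
      have := norm_sub_le ((m j : ℂ) / ((x - z j) * (x' - z j))
        + ∑ k ∈ Finset.univ.erase j, (m k : ℂ) / ((x - z k) * (x' - z k)))
        (∑ k ∈ Finset.univ.erase j, (m k : ℂ) / ((x - z k) * (x' - z k)))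
      rw [add_sub_cancel_right, e3] at this
      linarith
    have e7 := e5.trans e6
    rw [div_le_iff₀ (by positivity)] at e7
    linarith [hδm j]
  have := Finset.card_le_card_of_injOn (t := Finset.univ) p (fun _ _ => Finset.mem_univ _) hinj
  simpa using this

lemma far_point {n : ℕ} (z : Fin n → ℂ) {m : Fin n → ℝ} (hm : ∀ j, 0 < m j) (R : ℝ) :
    ∃ x, x ∈ Om z ∧ 0 < JJ z m x ∧ R ≤ ‖et z m x‖ := by
  set M := ∑ j, m j with hM
  have hM0 : 0 ≤ M := Finset.sum_nonneg fun j _ => (hm j).le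
  have hZ : ∀ j, ‖z j‖ ≤ ∑ j, ‖z j‖ := fun j =>
    Finset.single_le_sum (f := fun j => ‖z j‖) (fun j _ => norm_nonneg _) (Finset.mem_univ j)
  have hZ0 : 0 ≤ ∑ j, ‖z j‖ := Finset.sum_nonneg fun j _ => norm_nonneg _
  set Z := ∑ j, ‖z j‖ with hZdef
  let t : ℝ := |R| + Z + 2 * M + 2
  have ht : 0 ≤ t := by positivity
  have htn : ‖(t : ℂ)‖ = t := by rw [Complex.norm_real, Real.norm_of_nonneg ht]
  have hfar : ∀ j, M + 1 ≤ ‖(t : ℂ) - z j‖ := by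
    intro j
    have := norm_sub_norm_le (t : ℂ) (z j)
    rw [htn] at this
    have := hZ j
    simp only [t] at *
    linarith [abs_nonneg R]
  have hM1 : 0 < M + 1 := by linarith
  refine ⟨(t : ℂ), ?_, ?_, ?_⟩
  · intro j hj
    have := hfar j
    rw [hj, sub_self, norm_zero] at this
    linarith
  · have h3 := dr_bound z hm hM1 hfar
    have h4 : (∑ j, m j) / (M + 1) ^ 2 < 1 := by
      rw [div_lt_one (by positivity), ← hM]; nlinarith
    have h5 : ‖dr z m t‖ ^ 2 < 1 := pow_lt_one₀ (norm_nonneg _) (h3.trans_lt h4) two_ne_zero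
    unfold JJ
    linarith
  · have h3 := r0_bound z hm hM1 hfar
    have h4 : (∑ j, m j) / (M + 1) ≤ 1 := by
      rw [div_le_one hM1, ← hM]; linarith
    have h5 : ‖(t : ℂ)‖ ≤ ‖et z m t‖ + ‖r0 z m t‖ := by
      have : (t : ℂ) = et z m t + conj (r0 z m t) := by simp [et]
      calc ‖(t : ℂ)‖ = ‖et z m t + conj (r0 z m t)‖ := by rw [← this]
        _ ≤ _ := by
          refine (norm_add_le _ _).trans ?_
          rw [Complex.norm_conj]
    rw [htn] at h5
    simp only [t] at *
    linarith [le_abs_self R]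

def Op {n : ℕ} (z : Fin n → ℂ) (m : Fin n → ℝ) : Set ℂ := {x | x ∈ Om z ∧ 0 < JJ z m x}
def On {n : ℕ} (z : Fin n → ℂ) (m : Fin n → ℝ) : Set ℂ := {x | x ∈ Om z ∧ JJ z m x < 0}

lemma isOpen_Op {n : ℕ} (z : Fin n → ℂ) (m : Fin n → ℝ) : IsOpen (Op z m) :=
  (JJ_continuousOn z m).isOpen_inter_preimage (isOpen_Om z) isOpen_Ioi

lemma isOpen_On {n : ℕ} (z : Fin n → ℂ) (m : Fin n → ℝ) : IsOpen (On z m) :=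
  (JJ_continuousOn z m).isOpen_inter_preimage (isOpen_Om z) isOpen_Iio

lemma split_integral {n : ℕ} {z : Fin n → ℂ} (hz : Function.Injective z) {m : Fin n → ℝ}
    (hm : ∀ j, 0 < m j) {φ : ℂ → ℝ} (hφ : Continuous φ) (hφ0 : ∀ y, 1 < ‖y‖ → φ y = 0)
    (hpos : ∀ y, 0 ≤ φ y) (ζ : ℂ) :
    ∃ a b : ℝ, ∫ x in Om z, φ (et z m x - ζ) * JJ z m x = a - b ∧ 0 ≤ a ∧ 0 ≤ b ∧
      ∫⁻ x in Op z m, ENNReal.ofReal |JJ z m x| * ENNReal.ofReal (φ (et z m x - ζ))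
        = ENNReal.ofReal a ∧
      ∫⁻ x in On z m, ENNReal.ofReal |JJ z m x| * ENNReal.ofReal (φ (et z m x - ζ))
        = ENNReal.ofReal b := by
  have hi := phiJ_integrable hz hm hφ hφ0 ζ
  have hOm := (isOpen_Om z).measurableSet
  have e1 : ∫⁻ x in Op z m, ENNReal.ofReal |JJ z m x| * ENNReal.ofReal (φ (et z m x - ζ))
      = ∫⁻ x in Om z, ENNReal.ofReal (φ (et z m x - ζ) * JJ z m x) := by
    have hO := (isOpen_Op z m).measurableSet
    have : (Op z m) ∩ Om z = Op z m := inter_eq_left.2 fun x hx => hx.1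
    rw [← this, ← Measure.restrict_restrict hO, ← lintegral_indicator hO]
    refine setLIntegral_congr_fun hOm fun x hx => ?_
    by_cases h : x ∈ Op z m
    · simp only [indicator_of_mem h]
      rw [abs_of_pos h.2, ← ENNReal.ofReal_mul h.2.le, mul_comm]
    · simp only [indicator_of_notMem h]
      symm
      rw [ENNReal.ofReal_eq_zero]
      exact mul_nonpos_of_nonneg_of_nonpos (hpos _) (not_lt.1 fun h' => h ⟨hx, h'⟩)
  have e2 : ∫⁻ x in On z m, ENNReal.ofReal |JJ z m x| * ENNReal.ofReal (φ (et z m x - ζ))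
      = ∫⁻ x in Om z, ENNReal.ofReal (-(φ (et z m x - ζ) * JJ z m x)) := by
    have hO := (isOpen_On z m).measurableSet
    have : (On z m) ∩ Om z = On z m := inter_eq_left.2 fun x hx => hx.1
    rw [← this, ← Measure.restrict_restrict hO, ← lintegral_indicator hO]
    refine setLIntegral_congr_fun hOm fun x hx => ?_
    by_cases h : x ∈ On z m
    · simp only [indicator_of_mem h]
      rw [abs_of_neg h.2, ← ENNReal.ofReal_mul (by linarith [h.2])]
      congr 1; ring
    · simp only [indicator_of_notMem h]
      symm
      rw [ENNReal.ofReal_eq_zero, neg_nonpos]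
      exact mul_nonneg (hpos _) (not_lt.1 fun h' => h ⟨hx, h'⟩)
  refine ⟨_, _, integral_eq_lintegral_pos_part_sub_lintegral_neg_part hi,
    ENNReal.toReal_nonneg, ENNReal.toReal_nonneg, ?_, ?_⟩
  · rw [e1, ENNReal.ofReal_toReal hi.lintegral_lt_top.ne]
  · rw [e2]
    exact (ENNReal.ofReal_toReal hi.neg.lintegral_lt_top.ne).symm

lemma pos_fiber {n : ℕ} (hn : 2 ≤ n) {z : Fin n → ℂ} (hz : Function.Injective z) {m : Fin n → ℝ}
    (hm : ∀ j, 0 < m j) (y : ℂ) (S : Finset ℂ)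
    (hS : ∀ x ∈ S, (x ∈ Om z ∧ 0 ≤ JJ z m x) ∧ et z m x = y) : S.card ≤ 2 * n - 2 := by
  refine pos_count hn hz hm y S fun x hx => ?_
  obtain ⟨⟨h1, h2⟩, h3⟩ := hS x hx
  refine ⟨h1, ?_, ?_⟩
  · rw [← h3, et]; ring
  · unfold JJ at h2
    nlinarith [norm_nonneg (dr z m x)]

theorem neg_count {n : ℕ} (hn : 2 ≤ n) {z : Fin n → ℂ} (hz : Function.Injective z) {m : Fin n → ℝ}
    (hm : ∀ j, 0 < m j) (ζ : ℂ) (S : Finset ℂ)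
    (hS : ∀ x ∈ S, x ∈ On z m ∧ et z m x = ζ) : S.card ≤ 3 * n - 3 := by
  obtain ⟨R, hR⟩ := far_count hz hm
  obtain ⟨x1, hx1, hJ1, hR1⟩ := far_point z hm (R + 1)
  set ζ' := et z m x1 with hζ'
  obtain ⟨ε1, hε1, hl1⟩ := area_lower z m (isOpen_On z m) (fun x hx => hx.1)
    (fun x hx => hx.2.ne) ζ S hS
  obtain ⟨ε2, hε2, hl2⟩ := area_lower z m (isOpen_Op z m) (fun x hx => hx.1)
    (fun x hx => hx.2.ne') ζ' {x1} (by
      intro x hx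
      rw [Finset.mem_singleton] at hx
      subst hx
      exact ⟨⟨hx1, hJ1⟩, rfl⟩)
  set ε := min 1 (min ε1 ε2) with hε
  have hεpos : 0 < ε := by positivity
  let f : ContDiffBump (0:ℂ) := ⟨ε / 2, ε, by positivity, by linarith⟩
  let φ : ℂ → ℝ := f.normed volume
  have hφd : ContDiff ℝ 1 φ := f.contDiff_normed
  have hφp : ∀ y, 0 ≤ φ y := fun y => f.nonneg_normed y
  have hφs : ∀ y, y ∉ ball (0:ℂ) ε → φ y = 0 := by
    intro y hy
    have : Function.support φ = ball 0 ε := f.support_normed_eq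
    rw [← this] at hy
    simpa using hy
  have hφ0 : ∀ y, 1 < ‖y‖ → φ y = 0 := by
    intro y hy
    apply hφs
    rw [mem_ball_zero_iff, not_lt]
    exact (min_le_left _ _).trans hy.le
  have hφ1 : ∀ w, ∫⁻ y, ENNReal.ofReal (φ (y - w)) = 1 := by
    intro w
    rw [lintegral_sub_right_eq_self (fun y => ENNReal.ofReal (φ y)) w,
      ← ofReal_integral_eq_lintegral_ofReal f.integrable_normed (Eventually.of_forall hφp)]
    simp only [φ, f.integral_normed, ENNReal.ofReal_one]
  have hφm : ∀ w, Measurable fun y => ENNReal.ofReal (φ (y - w)) := fun w =>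
    (hφd.continuous.comp (continuous_id.sub continuous_const)).measurable.ennreal_ofReal
  have hsupp : ∀ w y, y ∉ ball w ε → ENNReal.ofReal (φ (y - w)) = 0 := by
    intro w y hy
    rw [hφs, ENNReal.ofReal_zero]
    rwa [mem_ball_zero_iff, ← dist_eq_norm, ← mem_ball]
  obtain ⟨a, b, hI, ha, hb, hA, hB⟩ := split_integral hz hm hφd.continuous hφ0 hφp ζ
  obtain ⟨a', b', hI', ha', hb', hA', hB'⟩ := split_integral hz hm hφd.continuous hφ0 hφp ζ'
  have hinv := invariance hz hm hφd hφ0 ζ ζ'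
  rw [hI, hI'] at hinv
  have u1 : a ≤ (2 * n - 2 : ℕ) := by
    have := area_upper z m (isOpen_Op z m) (fun x hx => hx.1) (fun x hx => hx.2.ne')
      (fun y => ENNReal.ofReal (φ (y - ζ))) (hφm ζ) (2 * n - 2) (fun y _ T hT =>
        pos_fiber hn hz hm y T fun x hx => ⟨⟨(hT x hx).1.1, (hT x hx).1.2.le⟩, (hT x hx).2⟩)
    rw [hA, hφ1, mul_one, ← ENNReal.ofReal_natCast] at this
    exact (ENNReal.ofReal_le_ofReal_iff (by positivity)).1 this
  have u2 : (S.card : ℝ) ≤ b := by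
    have := hl1 (fun y => ENNReal.ofReal (φ (y - ζ))) (fun y hy => hsupp ζ y fun h =>
      hy (ball_subset_ball ((min_le_right _ _).trans (min_le_left _ _)) h))
    rw [hB, hφ1, mul_one, ← ENNReal.ofReal_natCast] at this
    exact (ENNReal.ofReal_le_ofReal_iff hb).1 this
  have u3 : 1 ≤ a' := by
    have := hl2 (fun y => ENNReal.ofReal (φ (y - ζ'))) (fun y hy => hsupp ζ' y fun h =>
      hy (ball_subset_ball ((min_le_right _ _).trans (min_le_right _ _)) h))
    rw [hA', hφ1, mul_one, ← ENNReal.ofReal_natCast] at this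
    simpa using (ENNReal.ofReal_le_ofReal_iff ha').1 this
  have u4 : b' ≤ n := by
    have := area_upper z m (isOpen_On z m) (fun x hx => hx.1) (fun x hx => hx.2.ne)
      (fun y => ENNReal.ofReal (φ (y - ζ'))) (hφm ζ') n (fun y hy T hT => by
        have hyb : y ∈ ball ζ' ε := by
          by_contra h
          exact hy (hsupp ζ' y h)
        refine hR y ?_ T hT
        rw [mem_ball, dist_comm, dist_eq_norm] at hyb
        have h1 := norm_sub_norm_le ζ' y
        have h2 : ε ≤ 1 := min_le_left _ _
        linarith)
    rw [hB', hφ1, mul_one, ← ENNReal.ofReal_natCast] at this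
    exact (ENNReal.ofReal_le_ofReal_iff (by positivity)).1 this
  rw [Nat.cast_sub (by omega)] at u1
  push_cast at u1
  have : (S.card : ℝ) ≤ 3 * n - 3 := by linarith
  have h3 : S.card + 3 ≤ 3 * n := by
    have : ((S.card + 3 : ℕ) : ℝ) ≤ ((3 * n : ℕ) : ℝ) := by push_cast; linarith
    exact_mod_cast this
  omega

end KN

/-- Khavinson–Neumann, zero shear: a zero-shear point lens on
`n ≥ 2` masses produces at most `5n - 5` images of any source `ζ`. -/
theorem khavinson_neumann_zero_shear
    (n : ℕ) (hn : 2 ≤ n)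
    (z : Fin n → ℂ) (hz : Function.Injective z)
    (m : Fin n → ℝ) (hm : ∀ j, 0 < m j)
    (η : ℂ → ℂ)
    (hη : ∀ x : ℂ, η x =
      x - ∑ j, (m j : ℂ) / ((starRingEnd ℂ) x - (starRingEnd ℂ) (z j)))
    (ζ : ℂ) :
    {x : ℂ | (∀ j, x ≠ z j) ∧ η x = ζ}.Finite ∧
      {x : ℂ | (∀ j, x ≠ z j) ∧ η x = ζ}.ncard ≤ 5 * n - 5 := by
  have hηe : ∀ x, η x = KN.et z m x := by
    intro x
    rw [hη, KN.et, KN.r0, map_sum]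
    simp only [map_div₀, map_sub, Complex.conj_ofReal]
  have hcount : ∀ S : Finset ℂ, (↑S ⊆ {x : ℂ | (∀ j, x ≠ z j) ∧ η x = ζ}) → S.card ≤ 5 * n - 5 := by
    intro S hS
    classical
    rw [← Finset.card_filter_add_card_filter_not (s := S) (fun x => 0 ≤ KN.JJ z m x)]
    have h1 : (S.filter fun x => 0 ≤ KN.JJ z m x).card ≤ 2 * n - 2 := by
      refine KN.pos_fiber hn hz hm ζ _ fun x hx => ?_
      obtain ⟨hx1, hx2⟩ := Finset.mem_filter.1 hx
      obtain ⟨a, b⟩ := hS hx1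
      exact ⟨⟨a, hx2⟩, (hηe x) ▸ b⟩
    have h2 : (S.filter fun x => ¬ 0 ≤ KN.JJ z m x).card ≤ 3 * n - 3 := by
      refine KN.neg_count hn hz hm ζ _ fun x hx => ?_
      obtain ⟨hx1, hx2⟩ := Finset.mem_filter.1 hx
      obtain ⟨a, b⟩ := hS hx1
      exact ⟨⟨a, not_le.1 hx2⟩, (hηe x) ▸ b⟩
    omega
  have hfin : {x : ℂ | (∀ j, x ≠ z j) ∧ η x = ζ}.Finite := by
    by_contra hinf
    obtain ⟨T, hT, hTc⟩ := Set.Infinite.exists_subset_card_eq hinf (5 * n)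
    have := hcount T hT
    omega
  refine ⟨hfin, ?_⟩
  rw [Set.ncard_eq_toFinset_card _ hfin]
  exact hcount _ (by simp)
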